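/- arXiv:math/9812043 — 5 statements merged into one kernel-verified Lean document; each statement's English description precedes it below -/
import Mathlib

section
/- For all real η ≠ 0 and all real x, ξ, the improper integral over y ∈ ℝ satisfies ∫_ℝ e^{iξy} e^{-i(x+y)η/2} e^{i(x−y)²/(4η)} dy = 2√π · √(iη+0) · e^{i(ξ−η)x} e^{-i(ξ²η − ξη²)} e^{-iη³/4}. -/
open MeasureTheory Complex Filter Set

noncomputable section

/-- `√(iξ+0)`: the square root of `iξ` with the branch determined by
`arg(iξ+0) = π/2` for `ξ > 0` and `−π/2` for `ξ < 0`; equivalently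
`√(iξ+0) = √|ξ| · e^{iπ·sgn(ξ)/4}`. -/
def sqrtIPlusZero (ξ : ℝ) : ℂ :=
  (Real.sqrt |ξ| : ℂ) * Complex.exp (Complex.I * (Real.pi : ℂ) * (Real.sign ξ : ℂ) / 4)

lemma gff_line (E : ℂ → ℂ) (hE : ∀ z, HasDerivAt E (Complex.exp (-z ^ 2)) z) (p w : ℂ) (T : ℝ) :
    (∫ t in (0:ℝ)..T, Complex.exp (-(p + w * (t : ℂ)) ^ 2) * w) = E (p + w * T) - E p := by
  have h := intervalIntegral.integral_eq_sub_of_hasDerivAt (a := 0) (b := T)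
    (f := fun t : ℝ => E (p + w * (t : ℂ)))
    (f' := fun t : ℝ => Complex.exp (-(p + w * (t : ℂ)) ^ 2) * w)
    (by
      intro t _
      have h1 : HasDerivAt (fun z : ℂ => p + w * z) w (t : ℂ) := by
        simpa using ((hasDerivAt_id (t : ℂ)).const_mul w).const_add p
      exact ((hE (p + w * (t : ℂ))).comp (t : ℂ) h1).comp_ofReal)
    (Continuous.intervalIntegrable (by fun_prop) _ _)
  simpa using h

lemma gff_side (σ : ℝ) (hσ : σ ^ 2 = 1) (R : ℝ) (hR : 0 < R) :
    ‖∫ t in (0:ℝ)..R, Complex.exp (-((R : ℂ) + (σ * Complex.I) * (t : ℂ)) ^ 2) * (σ * Complex.I)‖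
      ≤ 1 / R := by
  have hb : ‖∫ t in (0:ℝ)..R, Complex.exp (-((R : ℂ) + (σ * Complex.I) * (t : ℂ)) ^ 2)
      * (σ * Complex.I)‖ ≤ ∫ t in (0:ℝ)..R, Real.exp (R * t - R ^ 2) := by
    apply intervalIntegral.norm_integral_le_of_norm_le hR.le
    · refine Eventually.of_forall fun t ht => ?_
      have hs : |σ| = 1 := by
        rw [← Real.sqrt_sq_eq_abs, hσ, Real.sqrt_one]
      have he : (-((R : ℂ) + (σ * Complex.I) * (t : ℂ)) ^ 2)
          = ((t ^ 2 - R ^ 2 : ℝ) : ℂ) + ((-2 * R * σ * t : ℝ) : ℂ) * Complex.I := by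
        have hσ' : (σ : ℂ) ^ 2 = 1 := by exact_mod_cast hσ
        push_cast
        linear_combination (-(σ:ℂ)^2 * t^2) * Complex.I_sq + (t:ℂ)^2 * hσ'
      rw [norm_mul, he, Complex.norm_exp]
      simp only [norm_mul, Complex.norm_real, Complex.norm_I, Real.norm_eq_abs, hs, mul_one]
      apply Real.exp_le_exp.mpr
      simp only [add_re, ofReal_re, re_ofReal_mul, I_re, mul_zero, add_zero]
      nlinarith [ht.1, ht.2]
    · exact Continuous.intervalIntegrable (by fun_prop) _ _
  refine hb.trans ?_
  have h := intervalIntegral.integral_eq_sub_of_hasDerivAt (a := 0) (b := R)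
    (f := fun t : ℝ => Real.exp (R * t - R ^ 2) / R)
    (f' := fun t : ℝ => Real.exp (R * t - R ^ 2))
    (by
      intro t _
      have h1 : HasDerivAt (fun t : ℝ => R * t - R ^ 2) R t := by
        simpa using ((hasDerivAt_id t).const_mul R).sub_const (R ^ 2)
      have h2 := h1.exp.div_const R
      rwa [mul_div_assoc, div_self hR.ne', mul_one] at h2)
    (Continuous.intervalIntegrable (by fun_prop) _ _)
  rw [h]
  have : 0 ≤ Real.exp (R * 0 - R ^ 2) / R := by positivity
  have h3 : R * R - R ^ 2 = 0 := by ring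
  simp only [h3, Real.exp_zero]
  linarith

lemma gff_diag (E : ℂ → ℂ) (hE : ∀ z, HasDerivAt E (Complex.exp (-z ^ 2)) z)
    (σ : ℝ) (hσ : σ ^ 2 = 1) :
    Tendsto (fun R : ℝ => E ((1 + σ * Complex.I) * R) - E 0) atTop
      (nhds ((Real.sqrt Real.pi : ℂ) / 2)) := by
  have h1 : Tendsto (fun R : ℝ => E R - E 0) atTop (nhds ((Real.sqrt Real.pi : ℂ) / 2)) := by
    have hi : IntegrableOn (fun t : ℝ => Real.exp (-1 * t ^ 2)) (Ioi 0) :=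
      (integrable_exp_neg_mul_sq one_pos).integrableOn
    have := intervalIntegral_tendsto_integral_Ioi 0 hi tendsto_id
    rw [integral_gaussian_Ioi] at this
    have h2 := (Complex.continuous_ofReal.tendsto _).comp this
    have h3 : ((√(Real.pi / 1) / 2 : ℝ) : ℂ) = (Real.sqrt Real.pi : ℂ) / 2 := by
      simp
    rw [h3] at h2
    refine h2.congr fun R => ?_
    have h4 := gff_line E hE 0 1 R
    simp only [zero_add, one_mul, mul_one] at h4
    rw [← h4]
    simp only [Function.comp, id]
    rw [← intervalIntegral.integral_ofReal]
    congr 1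
    ext t
    push_cast
    congr 1
    ring
  have h2 : Tendsto (fun R : ℝ => E ((1 + σ * Complex.I) * R) - E R) atTop (nhds 0) := by
    refine squeeze_zero_norm' (a := fun R : ℝ => 1 / R) ?_ (by
      simpa using tendsto_inv_atTop_zero (𝕜 := ℝ))
    filter_upwards [eventually_gt_atTop 0] with R hR
    have h4 := gff_line E hE R (σ * Complex.I) R
    have h5 := gff_side σ hσ R hR
    rw [h4] at h5
    have h6 : (1 + σ * Complex.I) * (R : ℂ) = R + σ * Complex.I * R := by ring
    rw [h6]
    exact h5
  have := h2.add h1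
  simpa using this

lemma gff_sqrt (η : ℝ) (hη : η ≠ 0) : ∃ σ c : ℝ, σ ^ 2 = 1 ∧ 0 < c ∧
    sqrtIPlusZero η ≠ 0 ∧ sqrtIPlusZero η ^ 2 = Complex.I * η ∧
    1 / (2 * sqrtIPlusZero η) = (1 + σ * Complex.I) * (c : ℂ) := by
  have hs : 0 < Real.sqrt |η| := Real.sqrt_pos.mpr (abs_pos.mpr hη)
  have h2 : 0 < Real.sqrt 2 := by positivity
  have hs2 : ((Real.sqrt |η| : ℝ) : ℂ) ^ 2 = ((|η| : ℝ) : ℂ) := by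
    rw [← Complex.ofReal_pow, Real.sq_sqrt (abs_nonneg _)]
  have h22 : ((Real.sqrt 2 : ℝ) : ℂ) ^ 2 = 2 := by
    rw [← Complex.ofReal_pow, Real.sq_sqrt (by norm_num)]; norm_num
  have hsc : ((Real.sqrt |η| : ℝ) : ℂ) ≠ 0 := by exact_mod_cast hs.ne'
  have h2c : ((Real.sqrt 2 : ℝ) : ℂ) ≠ 0 := by exact_mod_cast h2.ne'
  obtain ⟨s, hsσ, hsη, hss⟩ : ∃ s : ℝ, s ^ 2 = 1 ∧ s * |η| = η ∧
      sqrtIPlusZero η = (Real.sqrt |η| : ℂ) * ((1 + s * Complex.I) * (Real.sqrt 2 : ℂ) / 2) := by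
    rcases lt_or_gt_of_ne hη with h | h
    · refine ⟨-1, by norm_num, by rw [abs_of_neg h]; ring, ?_⟩
      unfold sqrtIPlusZero
      have : Complex.I * (Real.pi : ℂ) * (Real.sign η : ℂ) / 4
          = ((-(Real.pi / 4) : ℝ) : ℂ) * Complex.I := by
        rw [Real.sign_of_neg h]; push_cast; ring
      rw [this, Complex.exp_mul_I, ← Complex.ofReal_cos, ← Complex.ofReal_sin, Real.cos_neg,
        Real.sin_neg, Real.cos_pi_div_four, Real.sin_pi_div_four]
      push_cast; ring
    · refine ⟨1, by norm_num, by rw [abs_of_pos h]; ring, ?_⟩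
      unfold sqrtIPlusZero
      have : Complex.I * (Real.pi : ℂ) * (Real.sign η : ℂ) / 4
          = (((Real.pi / 4) : ℝ) : ℂ) * Complex.I := by
        rw [Real.sign_of_pos h]; push_cast; ring
      rw [this, Complex.exp_mul_I, ← Complex.ofReal_cos, ← Complex.ofReal_sin,
        Real.cos_pi_div_four, Real.sin_pi_div_four]
      push_cast; ring
  have hsσ' : (s : ℂ) ^ 2 = 1 := by exact_mod_cast hsσ
  have hsη' : (s : ℂ) * ((|η| : ℝ) : ℂ) = η := by exact_mod_cast hsη
  have hsq : sqrtIPlusZero η ^ 2 = Complex.I * η := by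
    rw [hss, mul_pow, hs2, div_pow, mul_pow, h22, ← hsη']
    linear_combination (((|η| : ℝ) : ℂ) / 2) * ((s:ℂ)^2 * Complex.I_sq - hsσ')
  have hne : sqrtIPlusZero η ≠ 0 := by
    intro h
    rw [h] at hsq
    have : Complex.I * (η : ℂ) ≠ 0 := mul_ne_zero Complex.I_ne_zero (by exact_mod_cast hη)
    exact this (by rw [← hsq]; ring)
  refine ⟨-s, 1 / (2 * (Real.sqrt |η| * Real.sqrt 2)), by simpa using hsσ, by positivity,
    hne, hsq, ?_⟩
  rw [div_eq_iff (mul_ne_zero two_ne_zero hne), hss]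
  push_cast
  field_simp
  linear_combination (s:ℂ)^2 * Complex.I_sq - hsσ'

lemma gff_fresnel (η : ℝ) (hη : η ≠ 0) :
    Tendsto (fun T : ℝ => ∫ t in (0:ℝ)..T, Complex.exp (Complex.I * (t : ℂ) ^ 2 / (4 * (η : ℂ))))
      atTop (nhds ((Real.sqrt Real.pi : ℂ) * sqrtIPlusZero η)) := by
  obtain ⟨σ, c, hσ, hc, hne, hsq, hw⟩ := gff_sqrt η hη
  obtain ⟨E, hE⟩ : ∃ E : ℂ → ℂ, ∀ z, HasDerivAt E (Complex.exp (-z ^ 2)) z := by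
    have hd : Differentiable ℂ (fun z : ℂ => Complex.exp (-z ^ 2)) := by fun_prop
    obtain ⟨E, hE⟩ := hd.isExactOn_univ
    exact ⟨E, fun z => hE z (mem_univ z)⟩
  have h1 := (gff_diag E hE σ hσ).comp (tendsto_id.const_mul_atTop hc)
  have h2 := h1.mul_const (2 * sqrtIPlusZero η)
  have h3 : (Real.sqrt Real.pi : ℂ) / 2 * (2 * sqrtIPlusZero η)
      = (Real.sqrt Real.pi : ℂ) * sqrtIPlusZero η := by ring
  rw [h3] at h2
  refine h2.congr fun T => ?_
  have h4 := gff_line E hE 0 (1 / (2 * sqrtIPlusZero η)) T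
  have hη' : (η : ℂ) ≠ 0 := by exact_mod_cast hη
  have h5 : ∀ t : ℝ, -(0 + 1 / (2 * sqrtIPlusZero η) * (t : ℂ)) ^ 2
      = Complex.I * (t : ℂ) ^ 2 / (4 * (η : ℂ)) := by
    intro t
    have : (0 + 1 / (2 * sqrtIPlusZero η) * (t : ℂ)) ^ 2
      = (t : ℂ) ^ 2 / (4 * sqrtIPlusZero η ^ 2) := by field_simp; ring
    rw [this, hsq]
    field_simp
    rw [Complex.I_sq]
    ring
  simp only [h5, intervalIntegral.integral_mul_const] at h4
  have h6 : (1 + σ * Complex.I) * ((c * T : ℝ) : ℂ) = 0 + 1 / (2 * sqrtIPlusZero η) * T := by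
    rw [hw]; push_cast; ring
  simp only [Function.comp, id]
  rw [h6, ← h4]
  field_simp

/-- For all real `η ≠ 0` and all real `x, ξ`, the improper integral
(limit of `∫_{-B}^{B}` as `B → ∞`) satisfies
`∫_ℝ e^{iξy} e^{-i(x+y)η/2} e^{i(x−y)²/(4η)} dy
  = 2√π · √(iη+0) · e^{i(ξ−η)x} e^{-i(ξ²η − ξη²)} e^{-iη³/4}`. -/
theorem gaussian_fresnel_integral_formula
    (η : ℝ) (hη : η ≠ 0) (x ξ : ℝ) :
    Tendsto
      (fun B : ℝ => ∫ y in (-B)..B,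
        Complex.exp (Complex.I * (ξ : ℂ) * (y : ℂ)) *
          Complex.exp (-Complex.I * ((x : ℂ) + (y : ℂ)) * (η : ℂ) / 2) *
          Complex.exp (Complex.I * ((x : ℂ) - (y : ℂ)) ^ 2 / (4 * (η : ℂ))))
      atTop
      (nhds (2 * (Real.sqrt Real.pi : ℂ) * sqrtIPlusZero η *
        Complex.exp (Complex.I * ((ξ : ℂ) - (η : ℂ)) * (x : ℂ)) *
        Complex.exp (-Complex.I * ((ξ : ℂ) ^ 2 * (η : ℂ) - (ξ : ℂ) * (η : ℂ) ^ 2)) *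
        Complex.exp (-Complex.I * (η : ℂ) ^ 3 / 4))) := by
  have hη' : (η : ℂ) ≠ 0 := by exact_mod_cast hη
  set K : ℂ := Complex.exp (Complex.I * ((ξ : ℂ) - (η : ℂ)) * (x : ℂ)) *
        Complex.exp (-Complex.I * ((ξ : ℂ) ^ 2 * (η : ℂ) - (ξ : ℂ) * (η : ℂ) ^ 2)) *
        Complex.exp (-Complex.I * (η : ℂ) ^ 3 / 4) with hK
  set d : ℝ := 2 * η * ξ - η ^ 2 - x with hd
  set g : ℝ → ℂ := fun t => Complex.exp (Complex.I * (t : ℂ) ^ 2 / (4 * (η : ℂ))) with hg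
  have hgc : Continuous g := by rw [hg]; fun_prop
  have hF := gff_fresnel η hη
  have hA : Tendsto (fun B : ℝ => ∫ t in (0:ℝ)..(B + d), g t) atTop
      (nhds ((Real.sqrt Real.pi : ℂ) * sqrtIPlusZero η)) :=
    hF.comp (tendsto_atTop_add_const_right _ d tendsto_id)
  have hB : Tendsto (fun B : ℝ => ∫ t in (0:ℝ)..(B + -d), g t) atTop
      (nhds ((Real.sqrt Real.pi : ℂ) * sqrtIPlusZero η)) :=
    hF.comp (tendsto_atTop_add_const_right _ (-d) tendsto_id)
  have hAB := (hA.add hB).mul_const K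
  have hl : ((Real.sqrt Real.pi : ℂ) * sqrtIPlusZero η + (Real.sqrt Real.pi : ℂ) * sqrtIPlusZero η)
      * K = 2 * (Real.sqrt Real.pi : ℂ) * sqrtIPlusZero η *
        Complex.exp (Complex.I * ((ξ : ℂ) - (η : ℂ)) * (x : ℂ)) *
        Complex.exp (-Complex.I * ((ξ : ℂ) ^ 2 * (η : ℂ) - (ξ : ℂ) * (η : ℂ) ^ 2)) *
        Complex.exp (-Complex.I * (η : ℂ) ^ 3 / 4) := by rw [hK]; ring
  rw [hl] at hAB
  refine hAB.congr fun B => ?_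
  have hpt : ∀ y : ℝ, Complex.exp (Complex.I * (ξ : ℂ) * (y : ℂ)) *
          Complex.exp (-Complex.I * ((x : ℂ) + (y : ℂ)) * (η : ℂ) / 2) *
          Complex.exp (Complex.I * ((x : ℂ) - (y : ℂ)) ^ 2 / (4 * (η : ℂ))) = g (y + d) * K := by
    intro y
    simp only [hg, hK, hd, ← Complex.exp_add]
    congr 1
    push_cast
    field_simp
    ring
  simp only [hpt, intervalIntegral.integral_mul_const]
  congr 1
  rw [intervalIntegral.integral_comp_add_right (fun t => g t)]
  have hneg : (∫ t in (0:ℝ)..(B + -d), g t) = ∫ t in (-B + d)..0, g t := by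
    have h := intervalIntegral.integral_comp_neg (a := 0) (b := B + -d) g
    have he : ∀ t, g (-t) = g t := by intro t; simp [hg]
    simp only [he] at h
    rw [h]
    congr 1 <;> ring
  rw [hneg, add_comm]
  exact intervalIntegral.integral_add_adjacent_intervals (hgc.intervalIntegrable _ _)
    (hgc.intervalIntegrable _ _)
end
end

section
/- For every Schwartz function f : ℝ → ℂ and every real x, the iterated improper integral (1/(√8 π)) ∫_ℝ ∫_ℝ ( f̂(ξ) / √(iξ+0) ) e^{iu²/(4ξ)} e^{-ixu} dξ du equals f(−x²). In other words, the symbol of the Wiener–Hopf operator associated with the convolution kernel (1/(√8 π)) ∫_ℝ ( f̂(ξ)/√(iξ+0) ) e^{i(x−y)²/(4ξ)} dξ is g(x) = f(−x²). -/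
open MeasureTheory Complex Filter Set

noncomputable section

/-- The Fourier transform `f̂(ξ) = (2π)^{-1/2} ∫ f(t) e^{-iξt} dt`. -/
def fourierHat (f : ℝ → ℂ) (ξ : ℝ) : ℂ :=
  (((2 * Real.pi : ℝ) ^ (-(1 : ℝ) / 2) : ℝ) : ℂ) *
    ∫ t : ℝ, f t * Complex.exp (-Complex.I * (ξ : ℂ) * (t : ℂ))


lemma wh_norm_exp (b : ℂ) (hb : 0 ≤ b.re) (v : ℝ) : ‖cexp (-b * (v:ℂ)^2)‖ ≤ 1 := by
  rw [Complex.norm_exp]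
  have : (-b * (v:ℂ)^2).re = - (b.re * v^2) := by
    rw [← Complex.ofReal_pow, Complex.re_mul_ofReal]; simp
  rw [this]
  exact Real.exp_le_one_iff.2 (neg_nonpos.2 (by positivity))

lemma wh_tail (b : ℂ) (hb : 0 ≤ b.re) (hb0 : b ≠ 0) (T S : ℝ) (hT : 0 < T) (hTS : T ≤ S) :
    ‖∫ v in T..S, cexp (-b * (v:ℂ)^2)‖ ≤ 1 / (‖b‖ * T) := by
  have hS : 0 < S := hT.trans_le hTS
  have hnb : 0 < ‖b‖ := norm_pos_iff.2 hb0
  have hpos : ∀ v ∈ uIcc T S, 0 < v := by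
    intro v hv
    rw [uIcc_of_le hTS] at hv
    exact hT.trans_le hv.1
  have hd : ∀ v ∈ uIcc T S, HasDerivAt (fun v : ℝ => cexp (-b * (v:ℂ)^2) / (-2 * b * (v:ℂ)))
      (cexp (-b * (v:ℂ)^2) + cexp (-b * (v:ℂ)^2) / (2 * b * (v:ℂ)^2)) v := by
    intro v hv
    have hv0 : (v:ℂ) ≠ 0 := by exact_mod_cast (hpos v hv).ne'
    have h1 : HasDerivAt (fun v : ℂ => cexp (-b * v^2) / (-2 * b * v))
      (cexp (-b * (v:ℂ)^2) + cexp (-b * (v:ℂ)^2) / (2 * b * (v:ℂ)^2)) (v:ℂ) := by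
      have h2 := (((hasDerivAt_pow 2 (v:ℂ)).const_mul (-b)).cexp).div
        ((hasDerivAt_id' (v:ℂ)).const_mul (-2*b)) (by simp [hb0, hv0])
      refine h2.congr_deriv ?_
      field_simp
      push_cast
      ring
    exact h1.comp_ofReal
  have hc1 : IntervalIntegrable (fun v : ℝ => cexp (-b * (v:ℂ)^2)) volume T S :=
    (by fun_prop : Continuous (fun v : ℝ => cexp (-b * (v:ℂ)^2))).intervalIntegrable _ _
  have hc2 : IntervalIntegrable (fun v : ℝ => cexp (-b * (v:ℂ)^2) / (2 * b * (v:ℂ)^2)) volume T S := by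
    apply ContinuousOn.intervalIntegrable
    apply ContinuousOn.div (by fun_prop) (by fun_prop)
    intro v hv
    have hv0 : (v:ℂ) ≠ 0 := by exact_mod_cast (hpos v hv).ne'
    simp [hb0, hv0]
  have hF := intervalIntegral.integral_eq_sub_of_hasDerivAt hd (hc1.add hc2)
  rw [intervalIntegral.integral_add hc1 hc2] at hF
  rw [eq_sub_of_add_eq hF]
  have hbd : ∀ v : ℝ, 0 < v → ‖cexp (-b * (v:ℂ)^2) / (-2 * b * (v:ℂ))‖ ≤ 1 / (2 * ‖b‖ * v) := by
    intro v hv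
    rw [norm_div]
    have : ‖-2 * b * (v:ℂ)‖ = 2 * ‖b‖ * v := by simp [abs_of_pos hv]
    rw [this]
    gcongr
    exact wh_norm_exp b hb v
  have hbi : ‖∫ v in T..S, cexp (-b * (v:ℂ)^2) / (2 * b * (v:ℂ)^2)‖ ≤ 
      ∫ v in T..S, 1 / (2 * ‖b‖ ) * (v^2)⁻¹ := by
    apply intervalIntegral.norm_integral_le_of_norm_le hTS
    · refine Eventually.of_forall fun v hv => ?_
      have hv0 : 0 < v := hT.trans hv.1
      rw [norm_div]
      have : ‖2 * b * (v:ℂ)^2‖ = 2 * ‖b‖ * v^2 := by simp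
      rw [this, ← one_div, div_mul_div_comm, one_mul]
      gcongr
      exact wh_norm_exp b hb v
    · apply ContinuousOn.intervalIntegrable
      apply ContinuousOn.mul (by fun_prop)
      apply ContinuousOn.inv₀ (by fun_prop)
      intro v hv
      exact pow_ne_zero _ (hpos v hv).ne'
  have hval : ∫ v in T..S, 1 / (2 * ‖b‖ ) * (v^2)⁻¹ = 1 / (2 * ‖b‖ ) * (1/T - 1/S) := by
    have hd : ∀ v ∈ uIcc T S, HasDerivAt (fun v : ℝ => 1 / (2 * ‖b‖ ) * (-v⁻¹)) (1 / (2 * ‖b‖ ) * (v^2)⁻¹) v := by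
      intro v hv
      have := ((hasDerivAt_inv (hpos v hv).ne').neg).const_mul (1 / (2 * ‖b‖ ))
      simpa using this
    rw [intervalIntegral.integral_eq_sub_of_hasDerivAt hd]
    · ring
    · apply ContinuousOn.intervalIntegrable
      apply ContinuousOn.mul (by fun_prop)
      apply ContinuousOn.inv₀ (by fun_prop)
      intro v hv
      exact pow_ne_zero _ (hpos v hv).ne'
  rw [hval] at hbi
  have e1 := hbd T hT
  have e2 := hbd S hS
  refine (norm_sub_le _ _).trans ((add_le_add (norm_sub_le _ _) hbi).trans ((add_le_add (add_le_add e2 e1) le_rfl).trans (le_of_eq ?_)))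
  field_simp
  ring

lemma wh_bound (b : ℂ) (hb : 0 ≤ b.re) (hb0 : b ≠ 0) (T : ℝ) :
    ‖∫ v in (0:ℝ)..T, cexp (-b * (v:ℂ)^2)‖ ≤ 2 / √‖b‖ := by
  have hnb : 0 < ‖b‖ := norm_pos_iff.2 hb0
  have hs : 0 < √‖b‖ := Real.sqrt_pos.2 hnb
  have hint : ∀ p q : ℝ, IntervalIntegrable (fun v : ℝ => cexp (-b * (v:ℂ)^2)) volume p q := fun p q =>
    (by fun_prop : Continuous (fun v : ℝ => cexp (-b * (v:ℂ)^2))).intervalIntegrable _ _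
  have hsmall : ∀ T : ℝ, 0 ≤ T → ‖∫ v in (0:ℝ)..T, cexp (-b * (v:ℂ)^2)‖ ≤ T := by
    intro T hT
    have := intervalIntegral.norm_integral_le_of_norm_le_const (a := 0) (b := T) (C := 1) (f := fun v : ℝ => cexp (-b * (v:ℂ)^2)) (fun v _ => wh_norm_exp b hb v)
    simpa [abs_of_nonneg hT] using this
  have key : ∀ T : ℝ, 0 ≤ T → ‖∫ v in (0:ℝ)..T, cexp (-b * (v:ℂ)^2)‖ ≤ 2 / √‖b‖ := by
    intro T hT
    rcases le_total T (1 / √‖b‖) with h | h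
    · refine (hsmall T hT).trans (h.trans ?_)
      gcongr; norm_num
    · rw [← intervalIntegral.integral_add_adjacent_intervals (hint 0 (1 / √‖b‖)) (hint _ T)]
      refine (norm_add_le _ _).trans ((add_le_add (hsmall _ (by positivity)) (wh_tail b hb hb0 _ _ (by positivity) h)).trans (le_of_eq ?_))
      have : ‖b‖ = √‖b‖ * √‖b‖ := (Real.mul_self_sqrt hnb.le).symm
      set s := √‖b‖
      rw [this]
      field_simp
      norm_num
  rcases le_total 0 T with h | h
  · exact key T h
  · have := key (-T) (by linarith)
    have h2 := intervalIntegral.integral_comp_neg (a := 0) (b := T) (fun v : ℝ => cexp (-b * (v:ℂ)^2))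
    simp only [ofReal_neg, neg_sq, neg_zero] at h2
    rw [h2, intervalIntegral.integral_symm, norm_neg]
    exact this

lemma wh_lim_pos (b : ℂ) (hb : 0 < b.re) (T : ℝ) (hT : 0 < T) :
    ‖(∫ v in (0:ℝ)..T, cexp (-b * (v:ℂ)^2)) - (Real.pi / b) ^ (1/2 : ℂ) / 2‖ ≤ 1 / (‖b‖ * T) := by
  have hb0 : b ≠ 0 := by rintro rfl; simp at hb
  have hint : ∀ p q : ℝ, IntervalIntegrable (fun v : ℝ => cexp (-b * (v:ℂ)^2)) volume p q := fun p q =>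
    (by fun_prop : Continuous (fun v : ℝ => cexp (-b * (v:ℂ)^2))).intervalIntegrable _ _
  have h1 := intervalIntegral_tendsto_integral_Ioi (0:ℝ) (integrable_cexp_neg_mul_sq hb).integrableOn tendsto_id
  rw [integral_gaussian_complex_Ioi hb] at h1
  have h2 := ((tendsto_const_nhds (x := ∫ v in (0:ℝ)..T, cexp (-b * (v:ℂ)^2)) (f := atTop)).sub h1).norm
  refine le_of_tendsto h2 ?_
  filter_upwards [eventually_ge_atTop T] with S hS
  rw [norm_sub_rev, id, intervalIntegral.integral_interval_sub_left (hint _ _) (hint _ _)]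
  exact wh_tail b hb.le hb0 T S hT hS

lemma wh_lim (b : ℂ) (hb : 0 ≤ b.re) (hb0 : b ≠ 0) :
    Tendsto (fun T : ℝ => ∫ v in (0:ℝ)..T, cexp (-b * (v:ℂ)^2)) atTop
      (nhds ((Real.pi / b) ^ (1/2 : ℂ) / 2)) := by
  have hnb : 0 < ‖b‖ := norm_pos_iff.2 hb0
  have key : ∀ T : ℝ, 0 < T → 
    ‖(∫ v in (0:ℝ)..T, cexp (-b * (v:ℂ)^2)) - (Real.pi / b) ^ (1/2 : ℂ) / 2‖ ≤ 1 / (‖b‖ * T) := by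
    intro T hT
    have hc : ContinuousAt (fun ε : ℝ => (b + (ε:ℂ))) 0 := by fun_prop
    have hc1 : ContinuousAt (fun ε : ℝ => ∫ v in (0:ℝ)..T, cexp (-(b + (ε:ℂ)) * (v:ℂ)^2)) 0 := by
      apply Continuous.continuousAt
      apply intervalIntegral.continuous_parametric_intervalIntegral_of_continuous'
      fun_prop
    have hc2 : ContinuousAt (fun ε : ℝ => (Real.pi / (b + (ε:ℂ))) ^ (1/2 : ℂ) / 2) 0 := by
      apply ContinuousAt.div_const
      apply ContinuousAt.cpow
      · exact continuousAt_const.div hc (by simpa using hb0)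
      · exact continuousAt_const
      · simp only [ofReal_zero, add_zero]
        have hns : 0 < normSq b := normSq_pos.2 hb0
        rw [mem_slitPlane_iff]
        rcases hb.lt_or_eq with h | h
        · left
          rw [Complex.div_re]; simp; positivity
        · right
          have him : b.im ≠ 0 := fun h' => hb0 (Complex.ext h.symm h')
          rw [Complex.div_im]; simp [Real.pi_ne_zero, him, hb0]
    have hc3 : ContinuousAt (fun ε : ℝ => 1 / (‖b + (ε:ℂ)‖ * T)) 0 := by
      apply continuousAt_const.div (by fun_prop)
      simp [hb0, hT.ne']
    have l := ((hc1.sub hc2).norm.tendsto).mono_left (nhdsWithin_le_nhds (s := Ioi 0))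
    have r := (hc3.tendsto).mono_left (nhdsWithin_le_nhds (s := Ioi 0))
    have := le_of_tendsto_of_tendsto l r (by
      filter_upwards [self_mem_nhdsWithin] with ε hε
      apply wh_lim_pos _ _ T hT
      simp only [add_re, ofReal_re]
      exact add_pos_of_nonneg_of_pos hb hε)
    simpa using this
  rw [tendsto_iff_norm_sub_tendsto_zero]
  have h0 : Tendsto (fun T : ℝ => 1 / (‖b‖ * T)) atTop (nhds 0) := by
    apply Tendsto.div_atTop tendsto_const_nhds
    exact tendsto_id.const_mul_atTop hnb
  refine squeeze_zero' (Eventually.of_forall fun _ => norm_nonneg _) ?_ h0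
  filter_upwards [eventually_gt_atTop 0] with T hT using key T hT

lemma wh_two_sided (b : ℂ) (d B : ℝ) :
    ∫ v in (-B - d)..(B - d), cexp (-b * (v:ℂ)^2) =
      (∫ v in (0:ℝ)..(B - d), cexp (-b * (v:ℂ)^2)) + ∫ v in (0:ℝ)..(B + d), cexp (-b * (v:ℂ)^2) := by
  have hint : ∀ p q : ℝ, IntervalIntegrable (fun v : ℝ => cexp (-b * (v:ℂ)^2)) volume p q := fun p q =>
    (by fun_prop : Continuous (fun v : ℝ => cexp (-b * (v:ℂ)^2))).intervalIntegrable _ _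
  have h2 := intervalIntegral.integral_comp_neg (a := 0) (b := B + d) (fun v : ℝ => cexp (-b * (v:ℂ)^2))
  simp only [ofReal_neg, neg_sq, neg_zero] at h2
  rw [h2, add_comm, show -B - d = -(B + d) by ring,
    intervalIntegral.integral_add_adjacent_intervals (hint _ _) (hint _ _)]

lemma wh_kernel (x ξ B : ℝ) (hξ : ξ ≠ 0) :
    ∫ u in (-B)..B, cexp (I * (u : ℂ) ^ 2 / (4 * (ξ : ℂ))) * cexp (-I * (x : ℂ) * (u : ℂ)) =
      cexp (-I * ξ * x^2) * ((∫ v in (0:ℝ)..(B - 2 * ξ * x), cexp (-(-I / (4 * ξ)) * (v:ℂ)^2)) +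
        ∫ v in (0:ℝ)..(B + 2 * ξ * x), cexp (-(-I / (4 * ξ)) * (v:ℂ)^2)) := by
  rw [← wh_two_sided, ← intervalIntegral.integral_comp_sub_right
    (fun v : ℝ => cexp (-(-I / (4 * ξ)) * (v:ℂ)^2)) (2 * ξ * x), ← intervalIntegral.integral_const_mul]
  congr 1
  ext u
  have : (ξ:ℂ) ≠ 0 := by exact_mod_cast hξ
  rw [← Complex.exp_add, ← Complex.exp_add]
  congr 1
  push_cast
  field_simp
  ring

lemma wh_b_norm (ξ : ℝ) : ‖-I / (4 * (ξ:ℂ))‖ = 1 / (4 * |ξ|) := by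
  simp

lemma wh_b_re (ξ : ℝ) : (-I / (4 * (ξ:ℂ))).re = 0 := by
  rw [show (4 * (ξ:ℂ)) = ((4 * ξ : ℝ) : ℂ) by push_cast; rfl, Complex.div_ofReal_re]
  simp

lemma wh_sqrt (ξ : ℝ) (hξ : ξ ≠ 0) :
    ((Real.pi : ℂ) / (-I / (4 * (ξ:ℂ)))) ^ (1/2 : ℂ) = 2 * (√Real.pi : ℝ) * sqrtIPlusZero ξ := by
  have hξ' : (ξ:ℂ) ≠ 0 := by exact_mod_cast hξ
  have hpi := Real.pi_pos
  have hss : Real.sign ξ = 1 ∨ Real.sign ξ = -1 := by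
    rcases lt_or_gt_of_ne hξ with h | h
    · right; exact Real.sign_of_neg h
    · left; exact Real.sign_of_pos h
  have hsq : (2 * (√Real.pi : ℝ) * sqrtIPlusZero ξ) ^ 2 = (Real.pi : ℂ) / (-I / (4 * (ξ:ℂ))) := by
    have e1 : ((√Real.pi : ℝ) : ℂ)^2 = Real.pi := by
      exact_mod_cast Real.sq_sqrt hpi.le
    have e2 : ((√|ξ| : ℝ) : ℂ)^2 = (|ξ| : ℝ) := by
      exact_mod_cast Real.sq_sqrt (abs_nonneg ξ)
    have e3 : cexp (I * (Real.pi : ℂ) * (Real.sign ξ : ℂ) / 4) ^ 2 = I * Real.sign ξ := by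
      rw [← Complex.exp_nat_mul]
      rcases hss with h | h <;> rw [h]
      · rw [show ((2:ℕ):ℂ) * (I * (Real.pi : ℂ) * ((1:ℝ) : ℂ) / 4) = Real.pi / 2 * I by push_cast; ring]
        simp [Complex.exp_pi_div_two_mul_I]
      · rw [show ((2:ℕ):ℂ) * (I * (Real.pi : ℂ) * ((-1:ℝ) : ℂ) / 4) = -Real.pi / 2 * I by push_cast; ring]
        simp [Complex.exp_neg_pi_div_two_mul_I]
    have e4 : ((|ξ| : ℝ) : ℂ) * (Real.sign ξ : ℝ) = ξ := by
      rw [← ofReal_mul]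
      rcases lt_or_gt_of_ne hξ with h | h
      · rw [Real.sign_of_neg h, abs_of_neg h]; simp
      · rw [Real.sign_of_pos h, abs_of_pos h]; simp
    rw [sqrtIPlusZero, mul_pow, mul_pow, mul_pow, e1, e2, e3]
    have : (Real.pi : ℂ) / (-I / (4 * (ξ:ℂ))) = 4 * Real.pi * ξ * I := by
      field_simp
      rw [I_sq]
    rw [this, ← e4]
    ring
  rw [← hsq]
  have harg : (2 * (√Real.pi : ℝ) * sqrtIPlusZero ξ).arg = Real.pi * Real.sign ξ / 4 := by
    have : 2 * ((√Real.pi : ℝ) : ℂ) * sqrtIPlusZero ξ = ((2 * √Real.pi * √|ξ| : ℝ) : ℂ) *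
      (Complex.cos ((Real.pi * Real.sign ξ / 4 : ℝ) : ℂ) + Complex.sin ((Real.pi * Real.sign ξ / 4 : ℝ) : ℂ) * I) := by
      rw [sqrtIPlusZero, ← Complex.exp_mul_I]
      push_cast
      rw [show (Real.pi : ℂ) * Real.sign ξ / 4 * I = I * Real.pi * Real.sign ξ / 4 by ring]
      ring
    rw [this]
    apply Complex.arg_mul_cos_add_sin_mul_I
    · have := abs_pos.2 hξ
      positivity
    · rcases hss with h | h <;> rw [h] <;> constructor <;> linarith
  have := Complex.pow_cpow_nat_inv (x := 2 * (√Real.pi : ℝ) * sqrtIPlusZero ξ) (n := 2) (by norm_num)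
    (by rw [harg]; push_cast; rcases hss with h | h <;> rw [h] <;> linarith)
    (by rw [harg]; push_cast; rcases hss with h | h <;> rw [h] <;> linarith)
  simpa using this

lemma wh_norm_sqrt (ξ : ℝ) : ‖sqrtIPlusZero ξ‖ = √|ξ| := by
  rw [sqrtIPlusZero, norm_mul, show I * (Real.pi : ℂ) * (Real.sign ξ : ℂ) / 4 = ((Real.pi * Real.sign ξ / 4 : ℝ) : ℂ) * I by push_cast; ring,
    Complex.norm_exp_ofReal_mul_I]
  simp

lemma wh_kernel_bound (x ξ B : ℝ) (hξ : ξ ≠ 0) :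
    ‖∫ u in (-B)..B, cexp (I * (u : ℂ) ^ 2 / (4 * (ξ : ℂ))) * cexp (-I * (x : ℂ) * (u : ℂ))‖
      ≤ 8 * √|ξ| := by
  have hb0 : -I / (4 * (ξ:ℂ)) ≠ 0 := by simp [hξ]
  rw [wh_kernel x ξ B hξ, norm_mul,
    show -I * (ξ:ℂ) * (x:ℂ)^2 = ((-ξ * x^2 : ℝ) : ℂ) * I by push_cast; ring, Complex.norm_exp_ofReal_mul_I, one_mul]
  refine (norm_add_le _ _).trans ((add_le_add (wh_bound _ (wh_b_re ξ).ge hb0 _) (wh_bound _ (wh_b_re ξ).ge hb0 _)).trans (le_of_eq ?_))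
  rw [wh_b_norm, Real.sqrt_div zero_le_one, Real.sqrt_mul (by norm_num), Real.sqrt_one,
    show (4:ℝ) = 2^2 by norm_num, Real.sqrt_sq (by norm_num)]
  field_simp
  norm_num

lemma wh_kernel_lim (x ξ : ℝ) (hξ : ξ ≠ 0) :
    Tendsto (fun B : ℝ => ∫ u in (-B)..B, cexp (I * (u : ℂ) ^ 2 / (4 * (ξ : ℂ))) * cexp (-I * (x : ℂ) * (u : ℂ)))
      atTop (nhds (cexp (-I * ξ * x^2) * (2 * (√Real.pi : ℝ) * sqrtIPlusZero ξ))) := by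
  have hb0 : -I / (4 * (ξ:ℂ)) ≠ 0 := by simp [hξ]
  simp_rw [wh_kernel x ξ _ hξ]
  apply Tendsto.const_mul
  have h := wh_lim _ (wh_b_re ξ).ge hb0
  rw [wh_sqrt ξ hξ] at h
  have h1 := h.comp (tendsto_atTop_add_const_right atTop (-(2 * ξ * x)) tendsto_id)
  have h2 := h.comp (tendsto_atTop_add_const_right atTop (2 * ξ * x) tendsto_id)
  have h3 := h1.add h2
  rw [add_halves] at h3
  exact h3

open scoped FourierTransform SchwartzMap

lemma wh_hat (f : SchwartzMap ℝ ℂ) (ξ : ℝ) : fourierHat f ξ =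
    (((2 * Real.pi : ℝ) ^ (-(1 : ℝ) / 2) : ℝ) : ℂ) * (𝓕 f) (ξ / (2 * Real.pi)) := by
  rw [fourierHat, SchwartzMap.fourier_coe, Real.fourier_real_eq_integral_exp_smul]
  congr 2
  ext t
  rw [smul_eq_mul, mul_comm]
  congr 2
  have := Real.pi_ne_zero
  push_cast
  field_simp

lemma wh_hat_continuous (f : SchwartzMap ℝ ℂ) : Continuous (fourierHat f) := by
  rw [show fourierHat f = _ from funext (wh_hat f)]
  have := (𝓕 f).continuous
  fun_prop

lemma wh_hat_integrable (f : SchwartzMap ℝ ℂ) : Integrable (fourierHat f) := by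
  rw [show fourierHat f = _ from funext (wh_hat f)]
  exact (((𝓕 f).integrable (μ := volume)).comp_div (by positivity)).const_mul _

lemma wh_hat_inv (f : SchwartzMap ℝ ℂ) (y : ℝ) :
    ∫ ξ, fourierHat f ξ * cexp (I * ξ * y) = (√(2 * Real.pi) : ℝ) * f y := by
  have h0 : f y = 𝓕⁻ (𝓕 f) y := by simp
  have hpi := Real.pi_pos
  rw [h0, SchwartzMap.fourierInv_coe, Real.fourierInv_eq']
  simp_rw [wh_hat]
  have h := Measure.integral_comp_div (fun w : ℝ => cexp (((2 * Real.pi * inner ℝ w y : ℝ)) * I) • (𝓕 f) w) (2 * Real.pi)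
  rw [abs_of_pos (by positivity)] at h
  have hc : ((√(2 * Real.pi) : ℝ) : ℂ) = (((2 * Real.pi : ℝ) ^ (-(1 : ℝ) / 2) : ℝ) : ℂ) * ((2 * Real.pi : ℝ) : ℂ) := by
    rw [← ofReal_mul]
    congr 1
    rw [Real.sqrt_eq_rpow]
    have h3 := Real.rpow_add (show 0 < 2 * Real.pi by positivity) (-(1:ℝ)/2) 1
    rw [Real.rpow_one] at h3
    rw [← h3]
    norm_num
  rw [hc, mul_assoc]
  rw [real_smul] at h
  rw [← h, ← integral_const_mul]
  congr 1
  ext ξ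
  rw [mul_assoc, smul_eq_mul, mul_comm ((𝓕 f _ : ℂ)) (cexp _)]
  congr 3
  simp
  field_simp

lemma wh_meas_sqrt : Measurable sqrtIPlusZero := by
  have : Measurable Real.sign := by
    unfold Real.sign
    exact Measurable.ite measurableSet_Iio measurable_const (Measurable.ite measurableSet_Ioi measurable_const measurable_const)
  unfold sqrtIPlusZero
  fun_prop

lemma wh_int (f : SchwartzMap ℝ ℂ) : Integrable (fun ξ => fourierHat f ξ / sqrtIPlusZero ξ) := by
  have hm : AEStronglyMeasurable (fun ξ => fourierHat f ξ / sqrtIPlusZero ξ) :=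
    ((wh_hat_continuous f).measurable.div wh_meas_sqrt).aestronglyMeasurable
  obtain ⟨M, hM⟩ := (isCompact_Icc (a := (-1:ℝ)) (b := 1)).exists_bound_of_continuousOn (wh_hat_continuous f).continuousOn
  have hpos : IntegrableOn (fun ξ : ℝ => ξ ^ (-(1/2) : ℝ)) (Ioc 0 1) := by
    have := (intervalIntegral.intervalIntegrable_rpow' (a := 0) (b := 1) (r := -(1/2)) (by norm_num)).1
    exact this
  have hpos' : IntegrableOn (fun ξ : ℝ => (√|ξ|)⁻¹) (Ioc 0 1) := by
    refine hpos.congr_fun (fun ξ hξ => ?_) measurableSet_Ioc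
    simp only
    rw [abs_of_pos hξ.1, Real.rpow_neg hξ.1.le, Real.sqrt_eq_rpow]
  have hii : IntervalIntegrable (fun ξ : ℝ => (√|ξ|)⁻¹) volume 0 1 := by
    rwa [intervalIntegrable_iff_integrableOn_Ioc_of_le zero_le_one]
  have hneg : IntervalIntegrable (fun ξ : ℝ => (√|ξ|)⁻¹) volume (-1) 0 := by
    have := hii.comp_sub_left 0
    simpa using this.symm
  have hall : IntegrableOn (fun ξ : ℝ => (√|ξ|)⁻¹) (Ioc (-1) 1) := by
    have := hneg.trans hii
    rwa [intervalIntegrable_iff_integrableOn_Ioc_of_le (by norm_num)] at this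
  have hdom : Integrable (fun ξ : ℝ => (Ioc (-1:ℝ) 1).indicator (fun ξ => M * (√|ξ|)⁻¹) ξ + ‖fourierHat f ξ‖) := by
    refine Integrable.add ?_ (wh_hat_integrable f).norm
    rw [integrable_indicator_iff measurableSet_Ioc]
    exact hall.const_mul M
  refine hdom.mono' hm (Eventually.of_forall fun ξ => ?_)
  rw [norm_div, wh_norm_sqrt, div_eq_mul_inv]
  by_cases h : ξ ∈ Ioc (-1:ℝ) 1
  · rw [indicator_of_mem h]
    have := hM ξ ⟨h.1.le, h.2⟩
    have h3 : ‖fourierHat f ξ‖ * (√|ξ|)⁻¹ ≤ M * (√|ξ|)⁻¹ := by gcongr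
    linarith [norm_nonneg (fourierHat f ξ)]
  · rw [indicator_of_notMem h, zero_add]
    have h1 : 1 ≤ |ξ| := by
      by_contra hh
      push Not at hh
      rw [abs_lt] at hh
      exact h ⟨hh.1, hh.2.le⟩
    have : (√|ξ|)⁻¹ ≤ 1 := inv_le_one_of_one_le₀ (Real.one_le_sqrt.2 h1)
    exact mul_le_of_le_one_right (norm_nonneg _) this

lemma wh_swap (f : SchwartzMap ℝ ℂ) (x B : ℝ) :
    ∫ u in (-B)..B, ∫ ξ : ℝ, (fourierHat (⇑f) ξ / sqrtIPlusZero ξ) *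
            Complex.exp (Complex.I * (u : ℂ) ^ 2 / (4 * (ξ : ℂ))) *
            Complex.exp (-Complex.I * (x : ℂ) * (u : ℂ)) =
    ∫ ξ : ℝ, (fourierHat (⇑f) ξ / sqrtIPlusZero ξ) * 
      ∫ u in (-B)..B, cexp (I * (u : ℂ) ^ 2 / (4 * (ξ : ℂ))) * cexp (-I * (x : ℂ) * (u : ℂ)) := by
  simp_rw [← intervalIntegral.integral_const_mul, ← mul_assoc]
  refine MeasureTheory.intervalIntegral_integral_swap ?_
  have : IsFiniteMeasure (volume.restrict (uIoc (-B) B)) := by unfold uIoc; infer_instance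
  have h1 := (integrable_const (1:ℂ) (μ := volume.restrict (uIoc (-B) B))).mul_prod (wh_int f)
  have hm1 : Measurable (fun ξ => fourierHat f ξ / sqrtIPlusZero ξ) :=
    (wh_hat_continuous f).measurable.div wh_meas_sqrt
  refine h1.mono ?_ (Eventually.of_forall ?_)
  · apply Measurable.aestronglyMeasurable
    have : Measurable (fun p : ℝ × ℝ => fourierHat f p.2 / sqrtIPlusZero p.2) :=
      hm1.comp measurable_snd
    simp only [Function.uncurry_def]
    apply Measurable.mul
    · apply Measurable.mul
      · exact this
      · fun_prop
    · fun_prop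
  · rintro ⟨u, ξ⟩
    simp only [Function.uncurry_apply_pair, one_mul]
    rw [norm_mul, norm_mul,
      show I * (u:ℂ) ^ 2 / (4 * (ξ:ℂ)) = ((u ^ 2 / (4 * ξ) : ℝ) : ℂ) * I by push_cast; ring,
      show -I * (x:ℂ) * (u:ℂ) = ((-x * u : ℝ) : ℂ) * I by push_cast; ring,
      Complex.norm_exp_ofReal_mul_I, Complex.norm_exp_ofReal_mul_I, mul_one, mul_one]

/-- For every Schwartz function `f` and every real `x`, the iterated
improper integral
`(1/(√8 π)) ∫_ℝ ∫_ℝ (f̂(ξ)/√(iξ+0)) e^{iu²/(4ξ)} e^{-ixu} dξ du` (inner integral over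
`ξ` absolutely convergent, outer integral understood as `lim_{B→∞} ∫_{-B}^{B}`)
equals `f(−x²)`: the symbol of the Wiener–Hopf operator with convolution kernel
`(1/(√8 π)) ∫ (f̂(ξ)/√(iξ+0)) e^{i(x−y)²/(4ξ)} dξ` is `g(x) = f(−x²)`. -/
theorem wiener_hopf_symbol_formula
    (f : SchwartzMap ℝ ℂ) (x : ℝ) :
    Tendsto
      (fun B : ℝ => (1 / (Real.sqrt 8 * Real.pi) : ℂ) *
        ∫ u in (-B)..B, ∫ ξ : ℝ,
          (fourierHat (⇑f) ξ / sqrtIPlusZero ξ) *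
            Complex.exp (Complex.I * (u : ℂ) ^ 2 / (4 * (ξ : ℂ))) *
            Complex.exp (-Complex.I * (x : ℂ) * (u : ℂ)))
      atTop (nhds (f (-x ^ 2))) := by
  have hae : ∀ᵐ ξ : ℝ, ξ ≠ 0 := by
    simp [ae_iff]
  have hpi := Real.pi_pos
  have key : Tendsto (fun B : ℝ => ∫ ξ : ℝ, (fourierHat (⇑f) ξ / sqrtIPlusZero ξ) * 
      ∫ u in (-B)..B, cexp (I * (u : ℂ) ^ 2 / (4 * (ξ : ℂ))) * cexp (-I * (x : ℂ) * (u : ℂ)))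
      atTop (nhds (∫ ξ : ℝ, 2 * (√Real.pi : ℝ) * (fourierHat f ξ * cexp (I * ξ * ((-x^2 : ℝ) : ℂ))))) := by
    apply tendsto_integral_filter_of_dominated_convergence (fun ξ => 8 * ‖fourierHat f ξ‖)
    · refine Eventually.of_forall fun B => ?_
      apply (wh_int f).aestronglyMeasurable.mul
      simp only [intervalIntegral.intervalIntegral_eq_integral_uIoc]
      apply AEStronglyMeasurable.const_smul
      apply StronglyMeasurable.aestronglyMeasurable
      apply StronglyMeasurable.integral_prod_right
      apply Measurable.stronglyMeasurable
      fun_prop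
    · refine Eventually.of_forall fun B => ?_
      filter_upwards [hae] with ξ hξ
      have h0 : 0 < √|ξ| := Real.sqrt_pos.2 (abs_pos.2 hξ)
      rw [norm_mul, norm_div, wh_norm_sqrt]
      calc _ ≤ ‖fourierHat f ξ‖ / √|ξ| * (8 * √|ξ|) := by
            gcongr
            exact wh_kernel_bound x ξ B hξ
        _ = _ := by field_simp
    · exact (wh_hat_integrable f).norm.const_mul 8
    · filter_upwards [hae] with ξ hξ
      have h0 : sqrtIPlusZero ξ ≠ 0 := by
        rw [← norm_ne_zero_iff, wh_norm_sqrt]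
        exact (Real.sqrt_pos.2 (abs_pos.2 hξ)).ne'
      have := (wh_kernel_lim x ξ hξ).const_mul (fourierHat (⇑f) ξ / sqrtIPlusZero ξ)
      convert this using 2
      field_simp
      congr 2
      push_cast
      ring
  simp_rw [wh_swap]
  have := key.const_mul (1 / (Real.sqrt 8 * Real.pi) : ℂ)
  convert this using 2
  rw [integral_const_mul, wh_hat_inv]
  have e : √8 * Real.pi = 2 * √Real.pi * √(2 * Real.pi) := by
    rw [Real.sqrt_mul (by norm_num), show (8:ℝ) = 2^2 * 2 by norm_num, Real.sqrt_mul (by norm_num), Real.sqrt_sq (by norm_num)]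
    nth_rw 1 [← Real.mul_self_sqrt hpi.le]
    ring
  have e' : ((√8:ℝ):ℂ) * Real.pi = 2 * ((√Real.pi : ℝ):ℂ) * ((√(2 * Real.pi) : ℝ) : ℂ) := by exact_mod_cast e
  rw [← mul_assoc, ← mul_assoc, mul_assoc (1 / _), ← e', one_div_mul_cancel, one_mul]
  have : √8 * Real.pi ≠ 0 := by positivity
  exact_mod_cast this
end
end

section
/- Let f : ℝ → ℂ be a Schwartz function. There is a constant C > 0 such that for all α ≥ 1 and all x, y ≥ 0, | (1/(√8 π)) ∫_ℝ ( f̂(ξ) / √(iξ+0) ) e^{-iξ³/(12α³)} ( e^{i(x−y)ξ/(2α^{3/2})} − 1 ) e^{i(x+y)²/(4ξ)} dξ | ≤ C α^{-3/2} / (1 + (x+y)²). -/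
open MeasureTheory Complex Filter Set

noncomputable section

/-- The oscillating integrand on the half line. -/
def oscKer (h : SchwartzMap ℝ ℂ) (p b c q ξ : ℝ) : ℂ :=
  h ξ * ((ξ ^ p : ℝ) : ℂ) * Complex.exp (((b * ξ ^ 3 + c * ξ + q / ξ : ℝ) : ℂ) * Complex.I)

lemma norm_oscKer (h : SchwartzMap ℝ ℂ) (p b c q : ℝ) {ξ : ℝ} (hξ : 0 ≤ ξ) :
    ‖oscKer h p b c q ξ‖ = ‖h ξ‖ * ξ ^ p := by
  rw [oscKer, norm_mul, norm_mul, Complex.norm_exp_ofReal_mul_I, mul_one, Complex.norm_real,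
    Real.norm_of_nonneg (Real.rpow_nonneg hξ p)]

lemma integrableOn_dom (h : SchwartzMap ℝ ℂ) (p : ℝ) (hp : -1 < p) :
    IntegrableOn (fun ξ : ℝ => ‖h ξ‖ * ξ ^ p) (Ioi 0) := by
  rw [← Ioc_union_Ioi_eq_Ioi (zero_le_one (α := ℝ))]
  have hm : Measurable (fun ξ : ℝ => ‖h ξ‖ * ξ ^ p) :=
    h.continuous.norm.measurable.mul (measurable_id.pow_const p)
  refine IntegrableOn.union ?_ ?_
  · have h1 : IntegrableOn (fun ξ : ℝ => (SchwartzMap.seminorm ℝ 0 0) h * ξ ^ p) (Ioc 0 1) := by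
      have := (intervalIntegral.intervalIntegrable_rpow' (a := 0) (b := 1) hp).1
      exact this.const_mul _
    refine h1.mono' hm.aestronglyMeasurable ?_
    filter_upwards [ae_restrict_mem measurableSet_Ioc] with ξ hξ
    have h0 : 0 ≤ ξ ^ p := Real.rpow_nonneg hξ.1.le p
    rw [Real.norm_of_nonneg (by positivity)]
    exact mul_le_mul_of_nonneg_right (SchwartzMap.norm_le_seminorm ℝ h ξ) h0
  · have h1 := (h.integrable_pow_mul volume ⌈p⌉₊).integrableOn (s := Ioi (1 : ℝ))
    refine h1.mono' hm.aestronglyMeasurable ?_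
    filter_upwards [ae_restrict_mem measurableSet_Ioi] with ξ hξ
    have hξ1 : (1 : ℝ) < ξ := hξ
    have h0 : 0 ≤ ξ ^ p := Real.rpow_nonneg (by linarith) p
    rw [Real.norm_of_nonneg (by positivity), mul_comm]
    refine mul_le_mul_of_nonneg_right ?_ (norm_nonneg _)
    rw [Real.norm_of_nonneg (by linarith), ← Real.rpow_natCast]
    exact Real.rpow_le_rpow_of_exponent_le hξ1.le (Nat.le_ceil p)

lemma measurable_oscKer (h : SchwartzMap ℝ ℂ) (p b c q : ℝ) :
    Measurable (oscKer h p b c q) := by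
  unfold oscKer
  have := h.continuous.measurable
  fun_prop

lemma integrableOn_oscKer (h : SchwartzMap ℝ ℂ) (p b c q : ℝ) (hp : -1 < p) :
    IntegrableOn (oscKer h p b c q) (Ioi 0) := by
  refine (integrableOn_dom h p hp).mono' (measurable_oscKer h p b c q).aestronglyMeasurable ?_
  filter_upwards [ae_restrict_mem measurableSet_Ioi] with ξ hξ
  rw [norm_oscKer h p b c q (le_of_lt hξ)]

lemma norm_int_oscKer_le (h : SchwartzMap ℝ ℂ) (p b c q : ℝ) :
    ‖∫ ξ in Ioi (0 : ℝ), oscKer h p b c q ξ‖ ≤ ∫ ξ in Ioi (0 : ℝ), ‖h ξ‖ * ξ ^ p := by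
  refine (norm_integral_le_integral_norm _).trans (le_of_eq ?_)
  refine setIntegral_congr_fun measurableSet_Ioi fun ξ hξ => ?_
  exact norm_oscKer h p b c q (le_of_lt hξ)

lemma hasDerivAt_oscKer (h : SchwartzMap ℝ ℂ) (p b c q : ℝ) {ξ : ℝ} (hξ : 0 < ξ) :
    HasDerivAt (oscKer h (p + 2) b c q)
      (oscKer (SchwartzMap.derivCLM ℂ ℂ h) (p + 2) b c q ξ
        + ((p + 2 : ℝ) : ℂ) * oscKer h (p + 1) b c q ξ
        + (3 * b * I) * oscKer h (p + 4) b c q ξ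
        + (c * I) * oscKer h (p + 2) b c q ξ
        - (q * I) * oscKer h p b c q ξ) ξ := by
  have h1 : HasDerivAt h (SchwartzMap.derivCLM ℂ ℂ h ξ) ξ := by
    rw [SchwartzMap.derivCLM_apply]
    exact h.differentiableAt.hasDerivAt
  have h2 : HasDerivAt (fun ξ : ℝ => ((ξ ^ (p + 2) : ℝ) : ℂ))
      (((p + 2) * ξ ^ (p + 2 - 1) : ℝ) : ℂ) ξ :=
    (Real.hasDerivAt_rpow_const (Or.inl hξ.ne')).ofReal_comp
  have h3 : HasDerivAt (fun ξ : ℝ => (b * ξ ^ 3 + c * ξ + q / ξ : ℝ))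
      (b * (3 * ξ ^ 2) + c - q / ξ ^ 2) ξ := by
    have ha := (hasDerivAt_pow 3 ξ).const_mul b
    have hb := (hasDerivAt_id ξ).const_mul c
    have hc := (hasDerivAt_inv hξ.ne').const_mul q
    convert! (ha.add hb).add hc using 1
    simp; field_simp; ring
  have h4 := (h3.ofReal_comp.mul_const I).cexp
  have h5 := (h1.mul h2).mul h4
  refine h5.congr_deriv ?_
  have e1 : ξ ^ (p + 2 - 1) = ξ ^ p * ξ := by
    rw [show p + 2 - 1 = p + 1 by ring, Real.rpow_add hξ, Real.rpow_one]
  have e1' : ξ ^ (p + 1) = ξ ^ p * ξ := by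
    rw [Real.rpow_add hξ, Real.rpow_one]
  have e2 : ξ ^ (p + 2) = ξ ^ p * ξ ^ 2 := by
    rw [Real.rpow_add hξ, ← Real.rpow_natCast]; norm_num
  have e4 : ξ ^ (p + 4) = ξ ^ p * ξ ^ 4 := by
    rw [Real.rpow_add hξ, ← Real.rpow_natCast]; norm_num
  have hne : (ξ : ℂ) ≠ 0 := by exact_mod_cast hξ.ne'
  simp only [oscKer, e1, e1', e2, e4, Pi.mul_apply]
  generalize Complex.exp (((b * ξ ^ 3 + c * ξ + q / ξ : ℝ) : ℂ) * Complex.I) = E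
  push_cast
  field_simp
  ring

lemma oscKer_ibp (h : SchwartzMap ℝ ℂ) (p b c q : ℝ) (hp : -1 < p) :
    (q * I) * ∫ ξ in Ioi (0 : ℝ), oscKer h p b c q ξ =
      (∫ ξ in Ioi (0 : ℝ), oscKer (SchwartzMap.derivCLM ℂ ℂ h) (p + 2) b c q ξ)
        + ((p + 2 : ℝ) : ℂ) * (∫ ξ in Ioi (0 : ℝ), oscKer h (p + 1) b c q ξ)
        + (3 * b * I) * (∫ ξ in Ioi (0 : ℝ), oscKer h (p + 4) b c q ξ)
        + (c * I) * (∫ ξ in Ioi (0 : ℝ), oscKer h (p + 2) b c q ξ) := by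
  have i1 := integrableOn_oscKer (SchwartzMap.derivCLM ℂ ℂ h) (p + 2) b c q (by linarith)
  have i2 := (integrableOn_oscKer h (p + 1) b c q (by linarith)).const_mul ((p + 2 : ℝ) : ℂ)
  have i3 := (integrableOn_oscKer h (p + 4) b c q (by linarith)).const_mul (3 * b * I)
  have i4' := integrableOn_oscKer h (p + 2) b c q (by linarith)
  have i4 := i4'.const_mul (c * I)
  have i5 := (integrableOn_oscKer h p b c q hp).const_mul (q * I)
  have hd := fun (ξ : ℝ) (hξ : ξ ∈ Ioi (0 : ℝ)) => hasDerivAt_oscKer h p b c q hξ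
  have hint := (((i1.add i2).add i3).add i4).sub i5
  have hlim := tendsto_zero_of_hasDerivAt_of_integrableOn_Ioi hd hint i4'
  have hzero : oscKer h (p + 2) b c q 0 = 0 := by
    simp [oscKer, Real.zero_rpow (show p + 2 ≠ 0 by linarith)]
  have hcont : ContinuousWithinAt (oscKer h (p + 2) b c q) (Ici 0) 0 := by
    rw [ContinuousWithinAt, hzero]
    have hb : ContinuousAt (fun ξ : ℝ => ‖h ξ‖ * ξ ^ (p + 2)) 0 :=
      h.continuous.norm.continuousAt.mul
        (Real.continuousAt_rpow_const _ _ (Or.inr (by linarith)))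
    have hb' := hb.continuousWithinAt (s := Ici 0)
    rw [ContinuousWithinAt, Real.zero_rpow (show p + 2 ≠ 0 by linarith), mul_zero] at hb'
    refine squeeze_zero_norm' ?_ hb'
    filter_upwards [self_mem_nhdsWithin] with ξ hξ
    rw [norm_oscKer h _ b c q hξ]
  have hI := integral_Ioi_of_hasDerivAt_of_tendsto hcont hd hint hlim
  rw [hzero, sub_zero] at hI
  have s1 := integral_sub (((i1.add i2).add i3).add i4) i5
  have s2 := integral_add ((i1.add i2).add i3) i4
  have s3 := integral_add (i1.add i2) i3
  have s4 := integral_add i1 i2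
  simp only [Pi.add_apply] at s1 s2 s3 s4
  rw [s1, s2, s3, s4, integral_const_mul, integral_const_mul, integral_const_mul,
    integral_const_mul] at hI
  linear_combination -hI

lemma oscKer_decay (n : ℕ) : ∀ (h : SchwartzMap ℝ ℂ) (p : ℝ), -1 < p →
    ∃ C : ℝ, 0 ≤ C ∧ ∀ b c q r : ℝ, |b| ≤ 1 → 1 ≤ r → |c| ≤ r → |q| = r ^ 2 →
      ‖∫ ξ in Ioi (0 : ℝ), oscKer h p b c q ξ‖ * r ^ n ≤ C := by
  induction n with
  | zero =>
    intro h p hp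
    refine ⟨∫ ξ in Ioi (0 : ℝ), ‖h ξ‖ * ξ ^ p, ?_, ?_⟩
    · exact (norm_nonneg _).trans (norm_int_oscKer_le h p 0 0 0)
    · intro b c q r _ _ _ _
      simpa using norm_int_oscKer_le h p b c q
  | succ n ih =>
    intro h p hp
    obtain ⟨C1, hC1, H1⟩ := ih (SchwartzMap.derivCLM ℂ ℂ h) (p + 2) (by linarith)
    obtain ⟨C2, hC2, H2⟩ := ih h (p + 1) (by linarith)
    obtain ⟨C3, hC3, H3⟩ := ih h (p + 4) (by linarith)
    obtain ⟨C4, hC4, H4⟩ := ih h (p + 2) (by linarith)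
    refine ⟨C1 + (p + 2) * C2 + 3 * C3 + C4, ?_, ?_⟩
    · have : 0 ≤ (p + 2) * C2 := mul_nonneg (by linarith) hC2
      positivity
    intro b c q r hb hr hc hq
    have G1 := H1 b c q r hb hr hc hq
    have G2 := H2 b c q r hb hr hc hq
    have G3 := H3 b c q r hb hr hc hq
    have G4 := H4 b c q r hb hr hc hq
    have key := congrArg norm (oscKer_ibp h p b c q hp)
    rw [norm_mul] at key
    have hqI : ‖(q : ℂ) * I‖ = r ^ 2 := by simp [hq]
    rw [hqI] at key
    set J := ‖∫ ξ in Ioi (0 : ℝ), oscKer h p b c q ξ‖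
    set J1 := ∫ ξ in Ioi (0 : ℝ), oscKer (SchwartzMap.derivCLM ℂ ℂ h) (p + 2) b c q ξ
    set J2 := ∫ ξ in Ioi (0 : ℝ), oscKer h (p + 1) b c q ξ
    set J3 := ∫ ξ in Ioi (0 : ℝ), oscKer h (p + 4) b c q ξ
    set J4 := ∫ ξ in Ioi (0 : ℝ), oscKer h (p + 2) b c q ξ
    have n2 : ‖((p + 2 : ℝ) : ℂ) * J2‖ = (p + 2) * ‖J2‖ := by
      rw [norm_mul, Complex.norm_real, Real.norm_of_nonneg (by linarith)]
    have n3 : ‖(3 * b * I) * J3‖ ≤ 3 * ‖J3‖ := by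
      rw [norm_mul]
      refine mul_le_mul_of_nonneg_right ?_ (norm_nonneg _)
      simpa using hb
    have n4 : ‖(c * I) * J4‖ ≤ r * ‖J4‖ := by
      rw [norm_mul]
      refine mul_le_mul_of_nonneg_right ?_ (norm_nonneg _)
      simpa using hc
    have tri : r ^ 2 * J ≤ ‖J1‖ + (p + 2) * ‖J2‖ + 3 * ‖J3‖ + r * ‖J4‖ := by
      rw [key]
      have t1 := norm_add_le (J1 + ((p + 2 : ℝ) : ℂ) * J2 + (3 * b * I) * J3) ((c * I) * J4)
      have t2 := norm_add_le (J1 + ((p + 2 : ℝ) : ℂ) * J2) ((3 * b * I) * J3)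
      have t3 := norm_add_le J1 (((p + 2 : ℝ) : ℂ) * J2)
      linarith
    have tri2 : r * (r * J) ≤ r * (‖J1‖ + (p + 2) * ‖J2‖ + 3 * ‖J3‖ + ‖J4‖) := by
      have a1 := mul_le_mul_of_nonneg_right hr (norm_nonneg J1)
      have a2 := mul_le_mul_of_nonneg_right hr
        (mul_nonneg (show 0 ≤ p + 2 by linarith) (norm_nonneg J2))
      have a3 := mul_le_mul_of_nonneg_right hr (norm_nonneg J3)
      nlinarith
    have tri3 := le_of_mul_le_mul_left tri2 (by linarith)
    have hrn : 0 ≤ r ^ n := by positivity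
    have tri4 := mul_le_mul_of_nonneg_right tri3 hrn
    have g2 := mul_le_mul_of_nonneg_left G2 (show 0 ≤ p + 2 by linarith)
    calc J * r ^ (n + 1) = r * J * r ^ n := by ring
      _ ≤ _ := tri4
      _ = ‖J1‖ * r ^ n + (p + 2) * (‖J2‖ * r ^ n) + 3 * (‖J3‖ * r ^ n) + ‖J4‖ * r ^ n := by ring
      _ ≤ _ := by linarith

lemma hasDerivAt_int_oscKer (h : SchwartzMap ℝ ℂ) (b c q : ℝ) :
    HasDerivAt (fun c => ∫ ξ in Ioi (0 : ℝ), oscKer h (-1 / 2) b c q ξ)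
      (∫ ξ in Ioi (0 : ℝ), I * oscKer h (1 / 2) b c q ξ) c := by
  refine (hasDerivAt_integral_of_dominated_loc_of_deriv_le
    (F := fun c ξ => oscKer h (-1 / 2) b c q ξ) (F' := fun c ξ => I * oscKer h (1 / 2) b c q ξ)
    (bound := fun ξ => ‖h ξ‖ * ξ ^ (1 / 2 : ℝ))
    (s := univ) Filter.univ_mem ?_ ?_ ?_ ?_ ?_ ?_).2
  · exact Filter.Eventually.of_forall fun c => (measurable_oscKer h _ b c q).aestronglyMeasurable
  · exact integrableOn_oscKer h _ b c q (by norm_num)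
  · exact ((measurable_oscKer h _ b c q).const_mul I).aestronglyMeasurable
  · filter_upwards [ae_restrict_mem measurableSet_Ioi] with ξ hξ c _
    rw [norm_mul, norm_oscKer h _ b c q (le_of_lt hξ)]
    simp
  · exact integrableOn_dom h _ (by norm_num)
  · filter_upwards [ae_restrict_mem measurableSet_Ioi] with ξ hξ c _
    have h3 : HasDerivAt (fun c : ℝ => (b * ξ ^ 3 + c * ξ + q / ξ : ℝ)) ξ c := by
      have := ((hasDerivAt_id c).mul_const ξ).const_add (b * ξ ^ 3) |>.add_const (q / ξ)
      simpa using this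
    have h4 := ((h3.ofReal_comp.mul_const I).cexp).const_mul (h ξ * ((ξ ^ (-1 / 2 : ℝ) : ℝ) : ℂ))
    refine h4.congr_deriv ?_
    have hξ' : (0 : ℝ) < ξ := hξ
    have e : ξ ^ (1 / 2 : ℝ) = ξ ^ (-1 / 2 : ℝ) * ξ := by
      conv_rhs => rw [← Real.rpow_add_one hξ'.ne']
      norm_num
    simp only [oscKer, e]
    push_cast
    ring

lemma oscKer_half (h : SchwartzMap ℝ ℂ) :
    ∃ C : ℝ, 0 ≤ C ∧ ∀ b c q r : ℝ, |b| ≤ 1 → 0 ≤ r → |c| ≤ r → |q| = r ^ 2 →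
      ‖∫ ξ in Ioi (0 : ℝ), (oscKer h (-1 / 2) b c q ξ - oscKer h (-1 / 2) b 0 q ξ)‖
        * (1 + r) ^ 3 ≤ C * |c| := by
  obtain ⟨C0, hC0, H0⟩ : ∃ C : ℝ, 0 ≤ C ∧ ∀ b c q : ℝ,
      ‖∫ ξ in Ioi (0 : ℝ), oscKer h (1 / 2) b c q ξ‖ ≤ C :=
    ⟨_, (norm_nonneg _).trans (norm_int_oscKer_le h (1 / 2) 0 0 0), norm_int_oscKer_le h (1 / 2)⟩
  obtain ⟨C3, hC3, H3⟩ := oscKer_decay 3 h (1 / 2) (by norm_num)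
  refine ⟨8 * (C0 + C3), by positivity, ?_⟩
  intro b c q r hb hr hc hq
  have hbd : ∀ c' : ℝ, |c'| ≤ r →
      ‖∫ ξ in Ioi (0 : ℝ), I * oscKer h (1 / 2) b c' q ξ‖ ≤ 8 * (C0 + C3) / (1 + r) ^ 3 := by
    intro c' hc'
    rw [integral_const_mul, norm_mul, Complex.norm_I, one_mul, le_div_iff₀ (by positivity)]
    rcases le_total r 1 with h1 | h1
    · have hp : (1 + r) ^ 3 ≤ 2 ^ 3 := by gcongr; linarith
      calc _ ≤ C0 * 2 ^ 3 := mul_le_mul (H0 b c' q) hp (by positivity) hC0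
        _ ≤ _ := by linarith
    · have hp : (1 + r) ^ 3 ≤ (2 * r) ^ 3 := by gcongr; linarith
      have := H3 b c' q r hb h1 hc' hq
      calc _ ≤ ‖∫ ξ in Ioi (0 : ℝ), oscKer h (1 / 2) b c' q ξ‖ * (2 * r) ^ 3 := by gcongr
        _ = 8 * (‖∫ ξ in Ioi (0 : ℝ), oscKer h (1 / 2) b c' q ξ‖ * r ^ 3) := by ring
        _ ≤ _ := by linarith
  have mv := Convex.norm_image_sub_le_of_norm_hasDerivWithin_le
    (f := fun c => ∫ ξ in Ioi (0 : ℝ), oscKer h (-1 / 2) b c q ξ) (s := Icc (-r) r)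
    (fun c' _ => (hasDerivAt_int_oscKer h b c' q).hasDerivWithinAt)
    (fun c' hc' => hbd c' (abs_le.2 hc')) (convex_Icc _ _)
    (show (0 : ℝ) ∈ Icc (-r) r from ⟨by linarith, hr⟩) (abs_le.1 hc)
  rw [integral_sub (integrableOn_oscKer h _ b c q (by norm_num))
    (integrableOn_oscKer h _ b 0 q (by norm_num))]
  rw [sub_zero, Real.norm_eq_abs] at mv
  calc _ ≤ 8 * (C0 + C3) / (1 + r) ^ 3 * |c| * (1 + r) ^ 3 := by gcongr
    _ = _ := by field_simp

lemma fourierHat_schwartz (f : SchwartzMap ℝ ℂ) (a : ℝ) (ha : a ≠ 0) :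
    ∃ h : SchwartzMap ℝ ℂ, ∀ ξ, h ξ = fourierHat f (a * ξ) := by
  have h2 : a / (2 * Real.pi) ≠ 0 := by positivity
  let e : ℝ ≃L[ℝ] ℝ := ContinuousLinearEquiv.smulLeft (Units.mk0 (a / (2 * Real.pi)) h2)
  refine ⟨(((2 * Real.pi : ℝ) ^ (-(1 : ℝ) / 2) : ℝ) : ℂ) •
    SchwartzMap.compCLMOfContinuousLinearEquiv ℂ e (FourierTransform.fourier f), ?_⟩
  intro ξ
  have he : e ξ = a / (2 * Real.pi) * ξ := rfl
  rw [SchwartzMap.smul_apply, SchwartzMap.compCLMOfContinuousLinearEquiv_apply,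
    Function.comp_apply, SchwartzMap.fourier_coe, Real.fourier_real_eq_integral_exp_smul,
    fourierHat, smul_eq_mul, he]
  congr 1
  refine integral_congr_ae (Filter.Eventually.of_forall fun t => ?_)
  have hpi : (Real.pi : ℂ) ≠ 0 := by exact_mod_cast Real.pi_ne_zero
  simp only [smul_eq_mul]
  rw [mul_comm]
  congr 2
  push_cast
  field_simp

/-- Let `f` be a Schwartz function.  There is a constant `C > 0`
such that for all `α ≥ 1` and all `x, y ≥ 0`,
`|(1/(√8 π)) ∫_ℝ (f̂(ξ)/√(iξ+0)) e^{-iξ³/(12α³)} (e^{i(x−y)ξ/(2α^{3/2})} − 1)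
  e^{i(x+y)²/(4ξ)} dξ| ≤ C α^{-3/2} / (1 + (x+y)²)`. -/
theorem error_kernel_bound_shift_factor
    (f : SchwartzMap ℝ ℂ) :
    ∃ C : ℝ, 0 < C ∧ ∀ α : ℝ, 1 ≤ α → ∀ x : ℝ, 0 ≤ x → ∀ y : ℝ, 0 ≤ y →
      ‖(1 / (Real.sqrt 8 * Real.pi) : ℂ) *
        ∫ ξ : ℝ,
          (fourierHat (⇑f) ξ / sqrtIPlusZero ξ) *
            Complex.exp (-Complex.I * (ξ : ℂ) ^ 3 / (12 * (α : ℂ) ^ 3)) *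
            (Complex.exp (Complex.I * ((x : ℂ) - (y : ℂ)) * (ξ : ℂ) /
              (2 * ((α ^ ((3 : ℝ) / 2) : ℝ) : ℂ))) - 1) *
            Complex.exp (Complex.I * ((x : ℂ) + (y : ℂ)) ^ 2 / (4 * (ξ : ℂ)))‖
        ≤ C * α ^ (-(3 : ℝ) / 2) / (1 + (x + y) ^ 2) := by
  obtain ⟨h1, hh1⟩ := fourierHat_schwartz f 1 one_ne_zero
  obtain ⟨h2, hh2⟩ := fourierHat_schwartz f (-1) (by norm_num)
  obtain ⟨C1, hC1, H1⟩ := oscKer_half h1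
  obtain ⟨C2, hC2, H2⟩ := oscKer_half h2
  refine ⟨4 * (C1 + C2) + 1, by positivity, ?_⟩
  intro α hα x hx y hy
  have hα0 : 0 < α := by linarith
  set A : ℝ := α ^ ((3 : ℝ) / 2) with hA
  have hA1 : 1 ≤ A := Real.one_le_rpow hα (by norm_num)
  have hAinv : α ^ (-(3 : ℝ) / 2) = A⁻¹ := by
    rw [hA, ← Real.rpow_neg hα0.le]; norm_num
  rw [hAinv]
  set b : ℝ := 1 / (12 * α ^ 3) with hb
  set c : ℝ := (x - y) / (2 * A) with hc
  set q : ℝ := (x + y) ^ 2 / 4 with hq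
  set r : ℝ := (x + y) / 2 with hr
  have hr0 : 0 ≤ r := by positivity
  have hxy : |x - y| ≤ x + y := by rw [abs_le]; constructor <;> linarith
  have hcr : |c| ≤ r * A⁻¹ := by
    rw [hc, abs_div, abs_of_pos (show 0 < 2 * A by linarith), hr]
    calc |x - y| / (2 * A) ≤ (x + y) / (2 * A) := by gcongr
      _ = _ := by field_simp
  have hcr' : |c| ≤ r := hcr.trans (mul_le_of_le_one_right hr0 (inv_le_one_of_one_le₀ hA1))
  have hb1 : |b| ≤ 1 := by
    rw [hb, abs_of_pos (by positivity), div_le_one (by positivity)]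
    have : 1 ≤ α ^ 3 := one_le_pow₀ hα
    linarith
  have hqr : |q| = r ^ 2 := by rw [hq, hr, abs_of_nonneg (by positivity)]; ring
  set G : ℝ → ℂ := fun ξ => (fourierHat (⇑f) ξ / sqrtIPlusZero ξ) *
            Complex.exp (-Complex.I * (ξ : ℂ) ^ 3 / (12 * (α : ℂ) ^ 3)) *
            (Complex.exp (Complex.I * ((x : ℂ) - (y : ℂ)) * (ξ : ℂ) /
              (2 * (A : ℂ))) - 1) *
            Complex.exp (Complex.I * ((x : ℂ) + (y : ℂ)) ^ 2 / (4 * (ξ : ℂ))) with hG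
  have hαc : (α : ℂ) ≠ 0 := by exact_mod_cast hα0.ne'
  have hAc : (A : ℂ) ≠ 0 := by exact_mod_cast (show A ≠ 0 by linarith)
  have gen : ∀ (F w : ℂ) (ξ u v z : ℝ), 0 < ξ → ∀ h : SchwartzMap ℝ ℂ, h ξ = F →
      F / ((Real.sqrt ξ : ℂ) * Complex.exp w) * Complex.exp ((u * ξ ^ 3 : ℝ) * I) *
        (Complex.exp ((v * ξ : ℝ) * I) - 1) * Complex.exp ((z / ξ : ℝ) * I) =
      Complex.exp (-w) * (oscKer h (-1 / 2) u v z ξ - oscKer h (-1 / 2) u 0 z ξ) := by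
    intro F w ξ u v z hξ h hF
    have hs : ξ ^ (-1 / 2 : ℝ) = (Real.sqrt ξ)⁻¹ := by
      rw [Real.sqrt_eq_rpow, ← Real.rpow_neg hξ.le]; norm_num
    simp only [oscKer, hF, hs]
    rw [Complex.exp_neg]
    push_cast
    simp only [add_mul, Complex.exp_add]
    simp only [zero_mul, Complex.exp_zero]
    field_simp
  have P1 : ∀ ξ ∈ Ioi (0 : ℝ), G ξ = Complex.exp (-(I * Real.pi / 4)) *
      (oscKer h1 (-1 / 2) (-b) c q ξ - oscKer h1 (-1 / 2) (-b) 0 q ξ) := by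
    intro ξ hξ
    have hξ' : (0 : ℝ) < ξ := hξ
    have hξc : (ξ : ℂ) ≠ 0 := by exact_mod_cast hξ'.ne'
    rw [← gen (fourierHat f ξ) _ ξ (-b) c q hξ' h1 (by rw [hh1, one_mul])]
    simp only [hG, sqrtIPlusZero, Real.sign_of_pos hξ', abs_of_pos hξ', hb, hc, hq]
    congr 1
    · congr 1
      · congr 1
        · congr 3
          push_cast; ring
        · congr 1
          push_cast; field_simp
      · congr 2
        push_cast; field_simp
    · congr 1
      push_cast; field_simp
  have P2 : ∀ ξ ∈ Ioi (0 : ℝ), G (-ξ) = Complex.exp (-(-(I * Real.pi / 4))) *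
      (oscKer h2 (-1 / 2) b (-c) (-q) ξ - oscKer h2 (-1 / 2) b 0 (-q) ξ) := by
    intro ξ hξ
    have hξ' : (0 : ℝ) < ξ := hξ
    have hξc : (ξ : ℂ) ≠ 0 := by exact_mod_cast hξ'.ne'
    rw [← gen (fourierHat f (-ξ)) _ ξ b (-c) (-q) hξ' h2 (by rw [hh2, neg_one_mul])]
    simp only [hG, sqrtIPlusZero, Real.sign_of_neg (neg_lt_zero.2 hξ'), abs_neg,
      abs_of_pos hξ', hb, hc, hq]
    congr 1
    · congr 1
      · congr 1
        · congr 3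
          push_cast; ring
        · congr 1
          push_cast; field_simp; try ring
      · congr 2
        push_cast; field_simp; try ring
    · congr 1
      push_cast; field_simp; try ring
  have I1 : IntegrableOn G (Ioi 0) := by
    refine IntegrableOn.congr_fun ?_ (fun ξ hξ => (P1 ξ hξ).symm) measurableSet_Ioi
    exact ((integrableOn_oscKer h1 _ _ _ _ (by norm_num)).sub
      (integrableOn_oscKer h1 _ _ _ _ (by norm_num))).const_mul _
  have I2' : IntegrableOn (fun ξ => G (-ξ)) (Ioi 0) := by
    refine IntegrableOn.congr_fun ?_ (fun ξ hξ => (P2 ξ hξ).symm) measurableSet_Ioi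
    exact ((integrableOn_oscKer h2 _ _ _ _ (by norm_num)).sub
      (integrableOn_oscKer h2 _ _ _ _ (by norm_num))).const_mul _
  have I2 : IntegrableOn G (Iic 0) := by
    rw [integrableOn_Iic_iff_integrableOn_Iio]
    have := (Measure.measurePreserving_neg (volume : Measure ℝ)).integrableOn_comp_preimage
      (Homeomorph.neg ℝ).measurableEmbedding (f := G) (s := Iio 0)
    rw [← this]
    simpa [Function.comp_def] using I2'
  have split : ∫ ξ, G ξ = (∫ ξ in Ioi (0 : ℝ), G ξ) + ∫ ξ in Ioi (0 : ℝ), G (-ξ) := by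
    rw [integral_comp_neg_Ioi, neg_zero, add_comm, intervalIntegral.integral_Iic_add_Ioi I2 I1]
  have B1 : ‖∫ ξ in Ioi (0 : ℝ), G ξ‖ * (1 + r) ^ 3 ≤ C1 * |c| := by
    rw [setIntegral_congr_fun measurableSet_Ioi P1, integral_const_mul, norm_mul,
      show -(I * (Real.pi : ℂ) / 4) = ((-(Real.pi / 4) : ℝ) : ℂ) * I by push_cast; ring,
      Complex.norm_exp_ofReal_mul_I, one_mul]
    exact H1 (-b) c q r (by rwa [abs_neg]) hr0 hcr' hqr
  have B2 : ‖∫ ξ in Ioi (0 : ℝ), G (-ξ)‖ * (1 + r) ^ 3 ≤ C2 * |c| := by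
    rw [setIntegral_congr_fun measurableSet_Ioi P2, integral_const_mul, norm_mul,
      show -(-(I * (Real.pi : ℂ) / 4)) = (((Real.pi / 4) : ℝ) : ℂ) * I by push_cast; ring,
      Complex.norm_exp_ofReal_mul_I, one_mul, ← abs_neg c]
    exact H2 b (-c) (-q) r hb1 hr0 (by rwa [abs_neg]) (by rwa [abs_neg])
  have hconst : ‖(1 / (Real.sqrt 8 * Real.pi) : ℂ)‖ ≤ 1 := by
    rw [show (1 / (Real.sqrt 8 * Real.pi) : ℂ) = ((1 / (Real.sqrt 8 * Real.pi) : ℝ) : ℂ) by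
      push_cast; rfl, Complex.norm_real, Real.norm_of_nonneg (by positivity),
      div_le_one (by positivity)]
    have e1 : (1 : ℝ) ≤ Real.sqrt 8 := by rw [Real.one_le_sqrt]; norm_num
    have e2 := Real.pi_gt_three
    nlinarith
  rw [norm_mul]
  refine (mul_le_of_le_one_left (norm_nonneg _) hconst).trans ?_
  rw [split, le_div_iff₀ (by positivity)]
  set N := ‖(∫ ξ in Ioi (0 : ℝ), G ξ) + ∫ ξ in Ioi (0 : ℝ), G (-ξ)‖ with hN
  have hN0 : 0 ≤ N := norm_nonneg _
  have hNle : N * (1 + r) ^ 3 ≤ (C1 + C2) * (r * A⁻¹) := by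
    have t := norm_add_le (∫ ξ in Ioi (0 : ℝ), G ξ) (∫ ξ in Ioi (0 : ℝ), G (-ξ))
    calc N * (1 + r) ^ 3 ≤ (‖∫ ξ in Ioi (0 : ℝ), G ξ‖ + ‖∫ ξ in Ioi (0 : ℝ), G (-ξ)‖)
          * (1 + r) ^ 3 := by gcongr
      _ ≤ (C1 + C2) * |c| := by linarith
      _ ≤ _ := by gcongr
  have hA0 : 0 < A⁻¹ := by positivity
  have h3 : (1 + r) * (N * (1 + r) ^ 2) ≤ (1 + r) * ((C1 + C2) * A⁻¹) := by
    have : 0 ≤ (C1 + C2) * A⁻¹ := by positivity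
    nlinarith
  have h4 := le_of_mul_le_mul_left h3 (by linarith)
  have h5 : 1 + (x + y) ^ 2 ≤ 4 * (1 + r) ^ 2 := by
    rw [hr]; nlinarith
  calc N * (1 + (x + y) ^ 2) ≤ N * (4 * (1 + r) ^ 2) := by gcongr
    _ ≤ 4 * ((C1 + C2) * A⁻¹) := by linarith
    _ ≤ _ := by linarith
end
end

section
/- Let f : ℝ → ℂ be a Schwartz function. There is a constant C > 0 such that for all α ≥ 1 and all x, y ≥ 0, | (1/(√8 π)) ∫_ℝ ( f̂(ξ) / √(iξ+0) ) ( e^{-iξ³/(12α³)} − 1 ) e^{i(x+y)²/(4ξ)} dξ | ≤ C α^{-3} / (1 + (x+y)²). -/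
open MeasureTheory Complex Filter Set

noncomputable section

lemma aux_norm_R (ξ : ℝ) : ‖(sqrtIPlusZero ξ)⁻¹‖ * |ξ| ≤ 1 + |ξ| := by
  have h1 : ‖Complex.exp (Complex.I * (Real.pi : ℂ) * (Real.sign ξ : ℂ) / 4)‖ = 1 := by
    have := Complex.norm_exp_I_mul_ofReal (Real.pi * Real.sign ξ / 4)
    rw [← this]; congr 2; push_cast; ring
  rw [sqrtIPlusZero, norm_inv, norm_mul, h1, mul_one, Complex.norm_real, Real.norm_eq_abs,
    abs_of_nonneg (Real.sqrt_nonneg _)]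
  have h2 := Real.mul_self_sqrt (abs_nonneg ξ)
  have h3 := Real.sqrt_nonneg |ξ|
  set q := Real.sqrt |ξ|
  rw [← h2]
  rcases h3.eq_or_lt with h | h
  · rw [← h]; simp
  · rw [← mul_assoc, inv_mul_cancel₀ h.ne']; nlinarith [sq_nonneg (q - 1)]

lemma aux_deriv_R (ξ : ℝ) (hξ : ξ ≠ 0) :
    HasDerivAt (fun t => (sqrtIPlusZero t)⁻¹) (-(sqrtIPlusZero ξ)⁻¹ / (2 * ξ)) ξ := by
  have key : ∀ (c : ℂ) (σ : ℝ), c ≠ 0 → 0 < σ * ξ → σ * σ = 1 →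
      sqrtIPlusZero =ᶠ[nhds ξ] (fun t => (Real.sqrt (σ * t) : ℂ) * c) →
      HasDerivAt (fun t => (sqrtIPlusZero t)⁻¹) (-(sqrtIPlusZero ξ)⁻¹ / (2 * ξ)) ξ := by
    intro c σ hc hpos hσ he
    have h0 : HasDerivAt (fun t : ℝ => σ * t) σ ξ := by
      simpa using (hasDerivAt_id ξ).const_mul σ
    have h1 : HasDerivAt (fun t : ℝ => Real.sqrt (σ * t)) (σ / (2 * Real.sqrt (σ * ξ))) ξ :=
      h0.sqrt hpos.ne'
    have h2 := (h1.ofReal_comp.mul_const c)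
    have hq : 0 < Real.sqrt (σ * ξ) := Real.sqrt_pos.2 hpos
    have hqc : (Real.sqrt (σ * ξ) : ℂ) ≠ 0 := by exact_mod_cast hq.ne'
    have h3 := h2.inv (mul_ne_zero hqc hc)
    have h4 := h3.congr_of_eventuallyEq (f₁ := fun t => (sqrtIPlusZero t)⁻¹)
      (he.mono (fun t ht => by simp [ht]))
    refine h4.congr_deriv ?_
    rw [he.self_of_nhds]
    have hqq : (Real.sqrt (σ * ξ) : ℂ) * (Real.sqrt (σ * ξ) : ℂ) = σ * ξ := by
      exact_mod_cast Real.mul_self_sqrt hpos.le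
    have hξc : (ξ : ℂ) ≠ 0 := by exact_mod_cast hξ
    have hσc : (σ : ℂ) * σ = 1 := by exact_mod_cast hσ
    set q : ℂ := (Real.sqrt (σ * ξ) : ℂ)
    push_cast
    field_simp
    grind
  rcases lt_or_gt_of_ne hξ with h | h
  · refine key (Complex.exp (Complex.I * (Real.pi : ℂ) * ((-1 : ℝ) : ℂ) / 4)) (-1)
      (Complex.exp_ne_zero _) (by linarith) (by norm_num) ?_
    filter_upwards [Iio_mem_nhds h] with t ht
    rw [sqrtIPlusZero, Real.sign_of_neg ht, abs_of_neg ht]; simp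
  · refine key (Complex.exp (Complex.I * (Real.pi : ℂ) * ((1 : ℝ) : ℂ) / 4)) 1
      (Complex.exp_ne_zero _) (by linarith) (by norm_num) ?_
    filter_upwards [Ioi_mem_nhds h] with t ht
    rw [sqrtIPlusZero, Real.sign_of_pos ht, abs_of_pos ht]; simp

/-- the total integral of a derivative with an exceptional point at zero -/
lemma aux_ftc (F F' : ℝ → ℂ) (K : ℝ) (hd : ∀ ξ, ξ ≠ 0 → HasDerivAt F (F' ξ) ξ)
    (hi : Integrable F') (h1 : ∀ ξ, ‖F ξ‖ ≤ K * |ξ|) (h2 : ∀ ξ, ‖F ξ‖ ≤ K * (1 + ξ ^ 2)⁻¹) :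
    ∫ ξ, F' ξ = 0 := by
  have hF0 : F 0 = 0 := by
    have := h1 0; simpa using this
  have hc : ContinuousAt F 0 := by
    rw [ContinuousAt, hF0]
    refine squeeze_zero_norm h1 ?_
    have : Continuous (fun ξ : ℝ => K * |ξ|) := by fun_prop
    simpa using this.tendsto 0
  have ht : Tendsto (fun ξ : ℝ => K * (1 + ξ ^ 2)⁻¹) (cocompact ℝ) (nhds 0) := by
    have a1 : Tendsto (fun ξ : ℝ => 1 + ξ ^ 2) (cocompact ℝ) atTop := by
      apply tendsto_atTop_add_const_left
      have := (tendsto_pow_atTop (two_ne_zero)).comp (tendsto_norm_cocompact_atTop (E := ℝ))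
      refine this.congr (fun x => ?_)
      simp
    simpa using a1.inv_tendsto_atTop.const_mul K
  have hT := squeeze_zero_norm h2 ht
  have hTop : Tendsto F atTop (nhds 0) := hT.mono_left atTop_le_cocompact
  have hBot : Tendsto F atBot (nhds 0) := hT.mono_left atBot_le_cocompact
  have e1 := integral_Ioi_of_hasDerivAt_of_tendsto (a := 0) hc.continuousWithinAt
    (fun x hx => hd x (ne_of_gt hx)) hi.integrableOn hTop
  have e2 := integral_Iic_of_hasDerivAt_of_tendsto (a := 0) hc.continuousWithinAt
    (fun x hx => hd x (ne_of_lt hx)) hi.integrableOn hBot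
  have e3 := intervalIntegral.integral_Iic_add_Ioi (b := (0 : ℝ)) hi.integrableOn hi.integrableOn
  rw [← e3, e1, e2, hF0]; simp

lemma aux_meas (g : ℝ → ℂ) (h : ∀ ξ, ξ ≠ 0 → ContinuousAt g ξ) :
    AEStronglyMeasurable g volume := by
  have h1 : ContinuousOn g ({0}ᶜ) := fun ξ hξ => (h ξ hξ).continuousWithinAt
  have h2 := h1.aestronglyMeasurable (μ := volume) (measurableSet_singleton (0 : ℝ)).compl
  rwa [restrict_compl_singleton] at h2

lemma aux_schwartz (g : SchwartzMap ℝ ℂ) : ∃ K, ∀ x, (1 + |x|) ^ 7 * ‖g x‖ ≤ K := by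
  refine ⟨2 ^ 7 * ((Finset.Iic (7, 0)).sup (fun m : ℕ × ℕ => SchwartzMap.seminorm ℝ m.1 m.2)) g,
    fun x => ?_⟩
  have := SchwartzMap.one_add_le_sup_seminorm_apply (𝕜 := ℝ) (m := (7, 0)) (k := 7) (n := 0)
    le_rfl le_rfl g x
  simpa using this

open FourierTransform in
lemma aux_fourier (f : SchwartzMap ℝ ℂ) : ∃ (φ' : ℝ → ℂ) (K : ℝ), 0 < K ∧ Continuous φ' ∧
    (∀ ξ, HasDerivAt (fourierHat f) (φ' ξ) ξ) ∧
    (∀ ξ, (1 + |ξ|) ^ 7 * ‖fourierHat f ξ‖ ≤ K) ∧ (∀ ξ, (1 + |ξ|) ^ 7 * ‖φ' ξ‖ ≤ K) := by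
  set ψ : SchwartzMap ℝ ℂ := 𝓕 f with hψ
  set c : ℂ := (((2 * Real.pi : ℝ) ^ (-(1 : ℝ) / 2) : ℝ) : ℂ)
  set b : ℝ := 2 * Real.pi with hb
  have hb1 : 1 ≤ b := by have := Real.pi_gt_three; linarith
  have hbp : 0 < b := by linarith
  have hEq : fourierHat f = fun ξ => c * ψ (b⁻¹ * ξ) := by
    funext ξ
    rw [fourierHat, hψ, SchwartzMap.fourier_coe, Real.fourier_real_eq_integral_exp_smul]
    congr 1
    apply integral_congr_ae
    refine Eventually.of_forall (fun t => ?_)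
    simp only [smul_eq_mul]
    rw [mul_comm]
    congr 2
    have : (b : ℂ) ≠ 0 := by exact_mod_cast hbp.ne'
    have hr : -2 * Real.pi * t * (b⁻¹ * ξ) = -(ξ * t) := by
      rw [show -2 * Real.pi * t * (b⁻¹ * ξ) = -(b * b⁻¹) * (ξ * t) by rw [hb]; ring,
        mul_inv_cancel₀ hbp.ne']; ring
    rw [hr]; push_cast; ring
  set ψ' := SchwartzMap.derivCLM ℝ ℂ ψ with hψ'
  obtain ⟨K1, hK1⟩ := aux_schwartz ψ
  obtain ⟨K2, hK2⟩ := aux_schwartz ψ'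
  have scale : ∀ (g : SchwartzMap ℝ ℂ) (K : ℝ) (_ : ∀ x, (1 + |x|) ^ 7 * ‖g x‖ ≤ K) (ξ : ℝ),
      (1 + |ξ|) ^ 7 * ‖g (b⁻¹ * ξ)‖ ≤ b ^ 7 * K := by
    intro g K hK ξ
    have h1 : 1 + |ξ| ≤ b * (1 + |b⁻¹ * ξ|) := by
      rw [abs_mul, abs_of_pos (inv_pos.2 hbp), mul_add, ← mul_assoc, mul_inv_cancel₀ hbp.ne']
      linarith
    calc (1 + |ξ|) ^ 7 * ‖g (b⁻¹ * ξ)‖ ≤ (b * (1 + |b⁻¹ * ξ|)) ^ 7 * ‖g (b⁻¹ * ξ)‖ := by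
          gcongr
      _ = b ^ 7 * ((1 + |b⁻¹ * ξ|) ^ 7 * ‖g (b⁻¹ * ξ)‖) := by ring
      _ ≤ _ := by gcongr; exact hK _
  refine ⟨fun ξ => c * (ψ' (b⁻¹ * ξ) * (b⁻¹ : ℝ)),
    1 + |‖c‖ * (b ^ 7 * K1)| + |‖c‖ * (b ^ 7 * K2 * b⁻¹)|, by positivity, ?_, ?_, ?_, ?_⟩
  · have := ψ'.continuous
    fun_prop
  · intro ξ
    rw [hEq]
    apply HasDerivAt.const_mul
    have h1 : HasDerivAt ψ (ψ' (b⁻¹ * ξ)) (b⁻¹ * ξ) := by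
      rw [hψ', SchwartzMap.derivCLM_apply]
      exact ψ.differentiableAt.hasDerivAt
    have h2 : HasDerivAt (fun t : ℝ => b⁻¹ * t) b⁻¹ ξ := by
      simpa using (hasDerivAt_id ξ).const_mul b⁻¹
    have := h1.scomp ξ h2
    refine HasDerivAt.congr_deriv this ?_
    rw [Complex.real_smul, mul_comm]
  · intro ξ
    rw [hEq]
    simp only [norm_mul]
    have h3 := mul_le_mul_of_nonneg_left (scale ψ K1 hK1 ξ) (norm_nonneg c)
    have h4 := le_abs_self (‖c‖ * (b ^ 7 * K1))
    have h5 := abs_nonneg (‖c‖ * (b ^ 7 * K2 * b⁻¹))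
    nlinarith
  · intro ξ
    simp only [norm_mul, Complex.norm_real, Real.norm_eq_abs, abs_of_pos (inv_pos.2 hbp)]
    have h3 := mul_le_mul_of_nonneg_left (scale ψ' K2 hK2 ξ)
      (mul_nonneg (norm_nonneg c) (inv_pos.2 hbp).le)
    have h4 := le_abs_self (‖c‖ * (b ^ 7 * K2 * b⁻¹))
    have h5 := abs_nonneg (‖c‖ * (b ^ 7 * K1))
    nlinarith

/-- elementary weight inequality -/
lemma aux_weight (a p A K B : ℝ) (k : ℕ) (hk : k ≤ 4) (ha : 0 ≤ a) (hp : 0 ≤ p) (hA : 0 ≤ A)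
    (hpa : p * a ≤ 1 + a) (hK : (1 + a) ^ 7 * A ≤ K) (hB : B ≤ A * (p * a ^ (k + 1))) :
    B * (1 + a ^ 2) ≤ K := by
  have h1 : p * a ^ (k + 1) ≤ (1 + a) ^ 5 := by
    calc p * a ^ (k + 1) = (p * a) * a ^ k := by ring
      _ ≤ (1 + a) * (1 + a) ^ k := by gcongr; linarith
      _ = (1 + a) ^ (k + 1) := by ring
      _ ≤ _ := pow_le_pow_right₀ (by linarith) (by omega)
  have h2 : 1 + a ^ 2 ≤ (1 + a) ^ 2 := by nlinarith
  calc B * (1 + a ^ 2) ≤ (A * (p * a ^ (k + 1))) * (1 + a ^ 2) := by gcongr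
    _ ≤ (A * (1 + a) ^ 5) * (1 + a) ^ 2 := by gcongr
    _ = (1 + a) ^ 7 * A := by ring
    _ ≤ K := hK

lemma aux_core (φ φ' : ℝ → ℂ) (K : ℝ) (hK : 0 < K) (hc : Continuous φ')
    (hd : ∀ ξ, HasDerivAt φ (φ' ξ) ξ)
    (hA : ∀ ξ, (1 + |ξ|) ^ 7 * ‖φ ξ‖ ≤ K) (hA' : ∀ ξ, (1 + |ξ|) ^ 7 * ‖φ' ξ‖ ≤ K)
    (m s : ℝ) (hm : 0 < m) (hs : 0 ≤ s) :
    ‖∫ ξ : ℝ, φ ξ * (sqrtIPlusZero ξ)⁻¹ * (Complex.exp (Complex.I * ((-(ξ ^ 3 / (12 * m)) : ℝ) : ℂ)) - 1)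
      * Complex.exp (Complex.I * ((s / (4 * ξ) : ℝ) : ℂ))‖ ≤
      (17 * K * Real.pi) * m⁻¹ / (1 + s) := by
  set R : ℝ → ℂ := fun ξ => (sqrtIPlusZero ξ)⁻¹ with hR
  set h : ℝ → ℂ := fun ξ => Complex.exp (Complex.I * ((-(ξ ^ 3 / (12 * m)) : ℝ) : ℂ)) - 1 with hh
  set E : ℝ → ℂ := fun ξ => Complex.exp (Complex.I * ((s / (4 * ξ) : ℝ) : ℂ)) with hE
  set h' : ℝ → ℂ := fun ξ => Complex.exp (Complex.I * ((-(ξ ^ 3 / (12 * m)) : ℝ) : ℂ)) *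
    (Complex.I * ((-(ξ ^ 2 / (4 * m)) : ℝ) : ℂ)) with hh'
  have dR : ∀ ξ, ξ ≠ 0 → HasDerivAt R (-R ξ / (2 * ξ)) ξ := aux_deriv_R
  have dh : ∀ ξ, HasDerivAt h (h' ξ) ξ := by
    intro ξ
    have h1 : HasDerivAt (fun ξ : ℝ => -(ξ ^ 3 / (12 * m))) (-(ξ ^ 2 / (4 * m))) ξ := by
      have := ((hasDerivAt_pow 3 ξ).div_const (12 * m)).neg
      refine this.congr_deriv ?_
      field_simp; norm_num; ring
    exact ((h1.ofReal_comp.const_mul Complex.I).cexp).sub_const 1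
  have dE : ∀ ξ, ξ ≠ 0 → HasDerivAt E (E ξ * (Complex.I * ((-(s / (4 * ξ ^ 2)) : ℝ) : ℂ))) ξ := by
    intro ξ hξ
    have h1 : HasDerivAt (fun ξ : ℝ => s / (4 * ξ)) (-(s / (4 * ξ ^ 2))) ξ := by
      have h0 : HasDerivAt (fun ξ : ℝ => 4 * ξ) 4 ξ := by
        simpa using (hasDerivAt_id ξ).const_mul 4
      have := (hasDerivAt_const ξ s).div h0 (by positivity)
      refine this.congr_deriv ?_
      field_simp; ring
    exact (h1.ofReal_comp.const_mul Complex.I).cexp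
  have nE : ∀ ξ, ‖E ξ‖ = 1 := fun ξ => Complex.norm_exp_I_mul_ofReal _
  have nh : ∀ ξ, ‖h ξ‖ ≤ |ξ| ^ 3 * m⁻¹ := by
    intro ξ
    refine (Real.norm_exp_I_mul_ofReal_sub_one_le).trans ?_
    rw [norm_neg, Real.norm_eq_abs, abs_div, abs_pow, abs_of_pos (by positivity : 0 < 12 * m),
      ← div_eq_mul_inv]
    gcongr; linarith
  have nh' : ∀ ξ, ‖h' ξ‖ ≤ |ξ| ^ 2 * m⁻¹ := by
    intro ξ
    rw [hh', norm_mul, norm_mul, Complex.norm_exp_I_mul_ofReal, Complex.norm_I, one_mul, one_mul,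
      Complex.norm_real, norm_neg, Real.norm_eq_abs, abs_div, abs_pow,
      abs_of_pos (by positivity : 0 < 4 * m), ← div_eq_mul_inv]
    gcongr; linarith
  have nR : ∀ ξ, ‖R ξ‖ * |ξ| ≤ 1 + |ξ| := aux_norm_R
  have W : ∀ (ξ : ℝ) (k : ℕ) (A B : ℝ), k ≤ 4 → 0 ≤ A → (1 + |ξ|) ^ 7 * A ≤ K →
      B ≤ A * (‖R ξ‖ * |ξ| ^ (k + 1)) * m⁻¹ → B ≤ K * m⁻¹ * (1 + ξ ^ 2)⁻¹ := by
    intro ξ k A B hk hA0 hAK hB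
    have := aux_weight |ξ| ‖R ξ‖ A K _ k hk (abs_nonneg _) (norm_nonneg _) hA0 (nR ξ) hAK le_rfl
    rw [sq_abs, ← le_div_iff₀ (by positivity)] at this
    calc B ≤ _ := hB
      _ ≤ (K / (1 + ξ ^ 2)) * m⁻¹ := by gcongr
      _ = _ := by rw [div_eq_mul_inv]; ring
  -- the pieces
  set G : ℝ → ℂ := fun ξ => φ ξ * R ξ * h ξ with hG
  set D : ℝ → ℂ := fun ξ => (3 / 2 : ℂ) * (ξ * φ ξ * R ξ * h ξ) + ξ ^ 2 * φ' ξ * R ξ * h ξ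
    + ξ ^ 2 * φ ξ * R ξ * h' ξ with hD
  have nG : ∀ ξ, ‖G ξ * E ξ‖ ≤ K * m⁻¹ * (1 + ξ ^ 2)⁻¹ := by
    intro ξ
    refine W ξ 2 ‖φ ξ‖ _ (by norm_num) (norm_nonneg _) (hA ξ) ?_
    simp only [hG, norm_mul, nE, mul_one]
    calc ‖φ ξ‖ * ‖R ξ‖ * ‖h ξ‖ ≤ ‖φ ξ‖ * ‖R ξ‖ * (|ξ| ^ 3 * m⁻¹) := by gcongr; exact nh ξ
      _ = _ := by ring
  have nD : ∀ ξ, ‖D ξ * E ξ‖ ≤ 4 * (K * m⁻¹ * (1 + ξ ^ 2)⁻¹) := by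
    intro ξ
    rw [norm_mul, nE, mul_one]
    have t1 : ‖(ξ * φ ξ * R ξ * h ξ : ℂ)‖ ≤ K * m⁻¹ * (1 + ξ ^ 2)⁻¹ := by
      refine W ξ 3 ‖φ ξ‖ _ (by norm_num) (norm_nonneg _) (hA ξ) ?_
      simp only [norm_mul, Complex.norm_real, Real.norm_eq_abs]
      calc |ξ| * ‖φ ξ‖ * ‖R ξ‖ * ‖h ξ‖ ≤ |ξ| * ‖φ ξ‖ * ‖R ξ‖ * (|ξ| ^ 3 * m⁻¹) := by
            gcongr; exact nh ξ
        _ = _ := by ring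
    have t2 : ‖(ξ ^ 2 * φ' ξ * R ξ * h ξ : ℂ)‖ ≤ K * m⁻¹ * (1 + ξ ^ 2)⁻¹ := by
      refine W ξ 4 ‖φ' ξ‖ _ (by norm_num) (norm_nonneg _) (hA' ξ) ?_
      simp only [norm_mul, norm_pow, Complex.norm_real, Real.norm_eq_abs]
      calc |ξ| ^ 2 * ‖φ' ξ‖ * ‖R ξ‖ * ‖h ξ‖ ≤ |ξ| ^ 2 * ‖φ' ξ‖ * ‖R ξ‖ * (|ξ| ^ 3 * m⁻¹) := by
            gcongr; exact nh ξ
        _ = _ := by ring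
    have t3 : ‖(ξ ^ 2 * φ ξ * R ξ * h' ξ : ℂ)‖ ≤ K * m⁻¹ * (1 + ξ ^ 2)⁻¹ := by
      refine W ξ 3 ‖φ ξ‖ _ (by norm_num) (norm_nonneg _) (hA ξ) ?_
      simp only [norm_mul, norm_pow, Complex.norm_real, Real.norm_eq_abs]
      calc |ξ| ^ 2 * ‖φ ξ‖ * ‖R ξ‖ * ‖h' ξ‖ ≤ |ξ| ^ 2 * ‖φ ξ‖ * ‖R ξ‖ * (|ξ| ^ 2 * m⁻¹) := by
            gcongr; exact nh' ξ
        _ = _ := by ring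
    have t4 : ‖(3 / 2 : ℂ) * (ξ * φ ξ * R ξ * h ξ)‖ = 3 / 2 * ‖(ξ * φ ξ * R ξ * h ξ : ℂ)‖ := by
      rw [norm_mul]; norm_num
    have t5 : ‖D ξ‖ ≤ _ := norm_add₃_le
    have t6 : 0 ≤ K * m⁻¹ * (1 + ξ ^ 2)⁻¹ := by positivity
    rw [t4] at t5
    linarith
  -- continuity away from zero
  have cφ : ∀ ξ, ContinuousAt φ ξ := fun ξ => (hd ξ).continuousAt
  have ch : ∀ ξ, ContinuousAt h ξ := fun ξ => (dh ξ).continuousAt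
  have ch' : ∀ ξ, ContinuousAt h' ξ := by
    intro ξ
    have : Continuous h' := by fun_prop
    exact this.continuousAt
  have cφ' : ∀ ξ, ContinuousAt φ' ξ := fun ξ => hc.continuousAt
  have cx : ∀ ξ : ℝ, ContinuousAt (fun t : ℝ => (t : ℂ)) ξ :=
    fun ξ => Complex.continuous_ofReal.continuousAt
  have mG : AEStronglyMeasurable (fun ξ => G ξ * E ξ) volume := by
    refine aux_meas _ (fun ξ hξ => ?_)
    have c1 := (dR ξ hξ).continuousAt
    have c2 := (dE ξ hξ).continuousAt
    exact (((cφ ξ).mul c1).mul (ch ξ)).mul c2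
  have mD : AEStronglyMeasurable (fun ξ => D ξ * E ξ) volume := by
    refine aux_meas _ (fun ξ hξ => ?_)
    have c1 := (dR ξ hξ).continuousAt
    have c2 := (dE ξ hξ).continuousAt
    refine ContinuousAt.mul ?_ c2
    refine ContinuousAt.add (ContinuousAt.add ?_ ?_) ?_
    · exact continuousAt_const.mul ((((cx ξ).mul (cφ ξ)).mul c1).mul (ch ξ))
    · exact ((((cx ξ).pow 2).mul (cφ' ξ)).mul c1).mul (ch ξ)
    · exact ((((cx ξ).pow 2).mul (cφ ξ)).mul c1).mul (ch' ξ)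
  have iB : Integrable (fun ξ : ℝ => K * m⁻¹ * (1 + ξ ^ 2)⁻¹) :=
    integrable_inv_one_add_sq.const_mul _
  have iG : Integrable (fun ξ => G ξ * E ξ) := iB.mono' mG (Eventually.of_forall nG)
  have iD : Integrable (fun ξ => D ξ * E ξ) :=
    (iB.const_mul 4).mono' mD (Eventually.of_forall nD)
  have vB : ∫ ξ : ℝ, K * m⁻¹ * (1 + ξ ^ 2)⁻¹ = K * m⁻¹ * Real.pi := by
    rw [integral_const_mul, integral_univ_inv_one_add_sq]
  have bG : ‖∫ ξ, G ξ * E ξ‖ ≤ K * m⁻¹ * Real.pi := by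
    rw [← vB]; exact norm_integral_le_of_norm_le iB (Eventually.of_forall nG)
  have bD : ‖∫ ξ, D ξ * E ξ‖ ≤ 4 * (K * m⁻¹ * Real.pi) := by
    rw [← vB, ← integral_const_mul]
    exact norm_integral_le_of_norm_le (iB.const_mul 4) (Eventually.of_forall nD)
  have key : ∫ ξ, (D ξ * E ξ - (Complex.I * s / 4) * (G ξ * E ξ)) = 0 := by
    refine aux_ftc (fun ξ => (ξ : ℂ) ^ 2 * G ξ * E ξ) _ (K * m⁻¹) ?_
      (iD.sub (iG.const_mul _)) ?_ ?_
    · intro ξ hξ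
      have hξc : (ξ : ℂ) ≠ 0 := by exact_mod_cast hξ
      have d0 : HasDerivAt (fun t : ℝ => (t : ℂ) ^ 2) (2 * ξ) ξ := by
        have h0 : HasDerivAt (fun t : ℝ => t ^ 2) (2 * ξ) ξ := by
          simpa using hasDerivAt_pow 2 ξ
        have h1 := h0.ofReal_comp
        simp only [Complex.ofReal_pow, Complex.ofReal_mul, Complex.ofReal_ofNat] at h1
        exact h1
      have := (d0.mul (((hd ξ).mul (dR ξ hξ)).mul (dh ξ))).mul (dE ξ hξ)
      refine this.congr_deriv ?_
      simp only [hG, hD, Pi.mul_apply]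
      push_cast
      field_simp
      ring
    · intro ξ
      have w : ‖R ξ‖ * |ξ| ^ 4 * ‖φ ξ‖ ≤ K := by
        have := aux_weight |ξ| ‖R ξ‖ ‖φ ξ‖ K _ 3 (by norm_num) (abs_nonneg _) (norm_nonneg _)
          (norm_nonneg _) (nR ξ) (hA ξ) le_rfl
        have p0 : 0 ≤ ‖φ ξ‖ * (‖R ξ‖ * |ξ| ^ (3 + 1)) := by positivity
        have p1 := mul_nonneg p0 (sq_nonneg |ξ|)
        calc ‖R ξ‖ * |ξ| ^ 4 * ‖φ ξ‖ = ‖φ ξ‖ * (‖R ξ‖ * |ξ| ^ (3 + 1)) := by ring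
          _ ≤ K := by linarith
      simp only [hG, norm_mul, norm_pow, nE, Complex.norm_real, Real.norm_eq_abs, mul_one]
      calc |ξ| ^ 2 * (‖φ ξ‖ * ‖R ξ‖ * ‖h ξ‖)
          ≤ |ξ| ^ 2 * (‖φ ξ‖ * ‖R ξ‖ * (|ξ| ^ 3 * m⁻¹)) := by gcongr; exact nh ξ
        _ = (‖R ξ‖ * |ξ| ^ 4 * ‖φ ξ‖) * m⁻¹ * |ξ| := by ring
        _ ≤ _ := by gcongr
    · intro ξ
      refine W ξ 4 ‖φ ξ‖ _ (by norm_num) (norm_nonneg _) (hA ξ) ?_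
      simp only [hG, norm_mul, norm_pow, nE, Complex.norm_real, Real.norm_eq_abs, mul_one]
      calc |ξ| ^ 2 * (‖φ ξ‖ * ‖R ξ‖ * ‖h ξ‖)
          ≤ |ξ| ^ 2 * (‖φ ξ‖ * ‖R ξ‖ * (|ξ| ^ 3 * m⁻¹)) := by gcongr; exact nh ξ
        _ = _ := by ring
  rw [integral_sub iD (iG.const_mul _), integral_const_mul, sub_eq_zero] at key
  rw [key, norm_mul, norm_div, norm_mul, Complex.norm_I, Complex.norm_real, Real.norm_eq_abs,
    abs_of_nonneg hs] at bD
  have n4 : ‖(4 : ℂ)‖ = 4 := by norm_num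
  rw [n4] at bD
  rw [le_div_iff₀ (by positivity)]
  change ‖∫ ξ, G ξ * E ξ‖ * (1 + s) ≤ _
  linarith

/-- Let `f` be a Schwartz function.  There is a constant `C > 0`
such that for all `α ≥ 1` and all `x, y ≥ 0`,
`|(1/(√8 π)) ∫_ℝ (f̂(ξ)/√(iξ+0)) (e^{-iξ³/(12α³)} − 1) e^{i(x+y)²/(4ξ)} dξ|
  ≤ C α^{-3} / (1 + (x+y)²)`. -/
theorem error_kernel_bound_cubic_factor
    (f : SchwartzMap ℝ ℂ) :
    ∃ C : ℝ, 0 < C ∧ ∀ α : ℝ, 1 ≤ α → ∀ x : ℝ, 0 ≤ x → ∀ y : ℝ, 0 ≤ y →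
      ‖(1 / (Real.sqrt 8 * Real.pi) : ℂ) *
        ∫ ξ : ℝ,
          (fourierHat (⇑f) ξ / sqrtIPlusZero ξ) *
            (Complex.exp (-Complex.I * (ξ : ℂ) ^ 3 / (12 * (α : ℂ) ^ 3)) - 1) *
            Complex.exp (Complex.I * ((x : ℂ) + (y : ℂ)) ^ 2 / (4 * (ξ : ℂ)))‖
        ≤ C * α ^ (-(3 : ℝ)) / (1 + (x + y) ^ 2) := by
  obtain ⟨φ', K, hK, hc, hd, hA, hA'⟩ := aux_fourier f
  refine ⟨17 * K * Real.pi, by positivity, ?_⟩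
  intro α hα x hx y hy
  have hα0 : 0 < α := by linarith
  have hcore := aux_core (fourierHat f) φ' K hK hc hd hA hA' (α ^ 3) ((x + y) ^ 2)
    (by positivity) (by positivity)
  have hα3 : α ^ (-(3 : ℝ)) = (α ^ 3)⁻¹ := by
    rw [Real.rpow_neg hα0.le]; norm_cast
  rw [hα3]
  refine le_trans ?_ hcore
  rw [norm_mul]
  have hn : ‖(1 / (Real.sqrt 8 * Real.pi) : ℂ)‖ ≤ 1 := by
    rw [norm_div, norm_one, norm_mul, Complex.norm_real, Complex.norm_real, Real.norm_eq_abs,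
      Real.norm_eq_abs, abs_of_pos Real.pi_pos, abs_of_nonneg (Real.sqrt_nonneg 8)]
    have h8 : 1 ≤ Real.sqrt 8 := Real.one_le_sqrt.2 (by norm_num)
    have hpi := Real.pi_gt_three
    rw [div_le_one (by positivity)]
    nlinarith
  refine (mul_le_of_le_one_left (norm_nonneg _) hn).trans (le_of_eq ?_)
  congr 2
  funext ξ
  rw [div_eq_mul_inv]
  congr 3
  · congr 2
    push_cast; ring
  · push_cast; ring
end
end

section
/- For every Schwartz function f : ℝ → ℂ, as α → ∞, (1/(√8 π)) ∫_0^∞ ∫_ℝ ( f̂(ξ) / √(iξ+0) ) e^{-iξ³/(12α³)} e^{-ixξ/α^{3/2}} dξ dx = (α^{3/2}/π) ∫_0^∞ √x · f(−x) dx + O(α^{-3/2}). (This is the trace of the operator P B_α(f) P.) -/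
open MeasureTheory Complex Filter Set Asymptotics

noncomputable section

/-- decay by two integrations by parts -/
lemma aux_decay (D D1 D2 : ℝ → ℂ) (h1 : ∀ x, HasDerivAt D (D1 x) x)
    (h2 : ∀ x, HasDerivAt D1 (D2 x) x) (i0 : Integrable D) (i1 : Integrable D1)
    (i2 : Integrable D2) (x : ℝ) :
    ‖∫ ξ : ℝ, D ξ * cexp (-I * x * ξ)‖ * (1 + x ^ 2) ≤ (∫ ξ, ‖D ξ‖) + ∫ ξ, ‖D2 ξ‖ := by
  have hn : ∀ ξ : ℝ, ‖cexp (-I * x * ξ)‖ = 1 := by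
    intro ξ
    rw [Complex.norm_exp]; simp
  have hc : Continuous fun ξ : ℝ => cexp (-I * x * ξ) := by fun_prop
  have hi : ∀ G : ℝ → ℂ, Integrable G → Integrable (fun ξ : ℝ => G ξ * cexp (-I * x * ξ)) := by
    intro G hG
    refine hG.mono (hG.aestronglyMeasurable.mul hc.aestronglyMeasurable) ?_
    filter_upwards with ξ
    rw [norm_mul, hn, mul_one]
  have hd : ∀ ξ : ℝ, HasDerivAt (fun ξ : ℝ => cexp (-I * x * ξ)) (-I * x * cexp (-I * x * ξ)) ξ := by
    intro ξ
    have := ((Complex.ofRealCLM.hasDerivAt (x := ξ)).const_mul (-I * x : ℂ)).cexp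
    simpa [mul_comm] using this
  have hp : ∀ G G1 : ℝ → ℂ, (∀ x, HasDerivAt G (G1 x) x) → Integrable G → Integrable G1 →
      (-I * x) * ∫ ξ : ℝ, G ξ * cexp (-I * x * ξ) = - ∫ ξ : ℝ, G1 ξ * cexp (-I * x * ξ) := by
    intro G G1 hG iG iG1
    have := integral_mul_deriv_eq_deriv_mul_of_integrable (u := G) (u' := G1)
      (v := fun ξ : ℝ => cexp (-I * x * ξ)) (v' := fun ξ : ℝ => -I * x * cexp (-I * x * ξ))
      (fun x _ => hG x) (fun x _ => hd x) ?_ (hi _ iG1) (hi _ iG)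
    · rw [← this, ← integral_const_mul]
      congr 1; ext ξ; ring
    · refine ((hi _ iG).const_mul (-I * x)).congr ?_
      filter_upwards with ξ
      simp only [Pi.mul_apply]; ring
  have e1 := hp D D1 h1 i0 i1
  have e2 := hp D1 D2 h2 i1 i2
  have e3 : (x : ℂ) ^ 2 * ∫ ξ : ℝ, D ξ * cexp (-I * x * ξ) = - ∫ ξ : ℝ, D2 ξ * cexp (-I * x * ξ) := by
    linear_combination (I * x) * e1 + e2 + (x : ℂ) ^ 2 * (∫ ξ : ℝ, D ξ * cexp (-I * x * ξ)) * I_sq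
  have b : ∀ G : ℝ → ℂ, ‖∫ ξ : ℝ, G ξ * cexp (-I * x * ξ)‖ ≤ ∫ ξ, ‖G ξ‖ := by
    intro G
    refine (norm_integral_le_integral_norm _).trans (le_of_eq ?_)
    congr 1; ext ξ; rw [norm_mul, hn, mul_one]
  have e4 := congrArg norm e3
  rw [norm_mul, norm_neg, norm_pow, Complex.norm_real, Real.norm_eq_abs, sq_abs] at e4
  have := b D
  have := b D2
  linarith

def JJ (x : ℝ) : ℝ := (1 + ‖x‖ ^ 2) ^ (-((4 / 3 : ℝ)) / 2)

lemma JJ_int : Integrable JJ := by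
  apply integrable_rpow_neg_one_add_norm_sq
  simp; norm_num

lemma JJ_nonneg (x : ℝ) : 0 ≤ JJ x := by unfold JJ; positivity

lemma JJ_le_one (x : ℝ) : JJ x ≤ 1 := by
  unfold JJ
  apply Real.rpow_le_one_of_one_le_of_nonpos
  · have := sq_nonneg ‖x‖; linarith
  · norm_num

lemma JJ_bound (y v x : ℝ) (hy : 0 ≤ y) (h : y ≤ x) (h' : v ^ 2 ≤ x) :
    1 / (1 + x ^ 2) ≤ 2 * (JJ y * JJ v) := by
  have hJ : ∀ t, JJ t ^ 3 * (1 + t ^ 2) ^ 2 = 1 := by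
    intro t
    have ht : (0:ℝ) < 1 + t ^ 2 := by positivity
    have e : JJ t ^ 3 = ((1 + t ^ 2) ^ 2)⁻¹ := by
      unfold JJ
      rw [Real.norm_eq_abs, sq_abs, ← Real.rpow_natCast, ← Real.rpow_mul ht.le,
        ← Real.rpow_natCast (1 + t ^ 2) 2, ← Real.rpow_neg ht.le]
      norm_num
    rw [e]; field_simp
  refine le_of_pow_le_pow_left₀ (n := 3) (by norm_num)
    (by have := JJ_nonneg y; have := JJ_nonneg v; positivity) ?_
  have e : (2 * (JJ y * JJ v)) ^ 3 = 8 / ((1 + y ^ 2) ^ 2 * (1 + v ^ 2) ^ 2) := by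
    rw [eq_div_iff (by positivity)]
    linear_combination 8 * (JJ v ^ 3 * (1 + v ^ 2) ^ 2) * hJ y + 8 * hJ v
  rw [e, div_pow, one_pow, div_le_div_iff₀ (by positivity) (by positivity)]
  have a1 : 1 + y ^ 2 ≤ 1 + x ^ 2 := by nlinarith
  have a2 : (1 + v ^ 2) ^ 2 ≤ 2 * (1 + x ^ 2) := by nlinarith [sq_nonneg (1 - v ^ 2), sq_nonneg v]
  have a3 : (1 + y ^ 2) ^ 2 ≤ (1 + x ^ 2) ^ 2 := by gcongr
  calc 1 * ((1 + y ^ 2) ^ 2 * (1 + v ^ 2) ^ 2) ≤ 1 * ((1 + x ^ 2) ^ 2 * (2 * (1 + x ^ 2))) := by gcongr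
    _ ≤ 8 * (1 + x ^ 2) ^ 3 := by nlinarith [show 0 < (1 + x ^ 2) ^ 3 by positivity]

lemma F_bound {F : ℝ → ℂ} {C : ℝ} (hF : ∀ x, ‖F x‖ * (1 + x ^ 2) ≤ C)
    (y v x : ℝ) (hy : 0 ≤ y) (h : y ≤ x) (h' : v ^ 2 ≤ x) : ‖F x‖ ≤ 2 * C * (JJ y * JJ v) := by
  have hC : 0 ≤ C := le_trans (by positivity) (hF 0)
  have : ‖F x‖ ≤ C * (1 / (1 + x ^ 2)) := by
    rw [mul_one_div, le_div_iff₀ (by positivity)]; exact hF x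
  refine this.trans ?_
  have := mul_le_mul_of_nonneg_left (JJ_bound y v x hy h h') hC
  linarith

lemma double_int (F : ℝ → ℂ) (C : ℝ) (hc : Continuous F) (hF : ∀ x, ‖F x‖ * (1 + x ^ 2) ≤ C) :
    ∫ y in Ioi (0 : ℝ), ∫ v in Ioi (0 : ℝ), F (y + v ^ 2) =
      ∫ x in Ioi (0 : ℝ), ((Real.sqrt x : ℝ) : ℂ) * F x := by
  have hJ : Integrable (fun p : ℝ × ℝ => 2 * C * (JJ p.1 * JJ p.2))
      ((volume.restrict (Ioi 0)).prod (volume.restrict (Ioi 0))) :=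
    ((JJ_int.restrict).mul_prod (JJ_int.restrict)).const_mul _
  rw [integral_integral_swap]
  · have : ∀ v : ℝ, ∫ y in Ioi (0 : ℝ), F (y + v ^ 2) =
        ∫ x in Ioi (0 : ℝ), (Ioi (v ^ 2)).indicator F x := by
      intro v
      rw [setIntegral_indicator measurableSet_Ioi, Ioi_inter_Ioi, max_eq_right (by positivity),
        ← integral_indicator measurableSet_Ioi, ← integral_indicator measurableSet_Ioi,
        ← integral_add_right_eq_self ((Ioi (v ^ 2)).indicator F) (v ^ 2)]
      congr 1; ext y
      simp [indicator_apply]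
    simp_rw [this]
    rw [integral_integral_swap]
    · refine setIntegral_congr_fun measurableSet_Ioi fun x hx => ?_
      have hx : 0 < x := hx
      have e : ∀ v ∈ Ioi (0 : ℝ), (Ioi (v ^ 2)).indicator F x =
          (Iio (√x)).indicator (fun _ => F x) v := by
        intro v hv
        simp only [indicator_apply, mem_Ioi, mem_Iio, Real.lt_sqrt (le_of_lt hv)]
      rw [setIntegral_congr_fun measurableSet_Ioi e, setIntegral_indicator measurableSet_Iio,
        Ioi_inter_Iio, setIntegral_const]
      simp [Measure.real, Real.sqrt_nonneg]
    · refine (((JJ_int.restrict).mul_prod (JJ_int.restrict)).const_mul (2 * C)).mono' ?_ ?_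
      · have : Function.uncurry (fun v x : ℝ => (Ioi (v ^ 2)).indicator F x) =
          {p : ℝ × ℝ | p.1 ^ 2 < p.2}.indicator (fun p => F p.2) := by
          ext ⟨v, x⟩; simp [indicator_apply]
        rw [this]
        refine ((hc.comp continuous_snd).measurable.indicator ?_).aestronglyMeasurable
        exact (isOpen_lt (by fun_prop) (by fun_prop)).measurableSet
      · rw [Measure.prod_restrict]
        refine (ae_restrict_iff' (measurableSet_Ioi.prod measurableSet_Ioi)).2 ?_
        filter_upwards with p hp
        obtain ⟨v, x⟩ := p
        simp only [Function.uncurry, indicator_apply, mem_Ioi]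
        have hx : 0 < x := hp.2
        split_ifs with h
        · rw [mul_comm (JJ v)]
          exact F_bound hF x v x hx.le le_rfl h.le
        · have hC : 0 ≤ C := le_trans (by positivity) (hF 0)
          have := JJ_nonneg v; have := JJ_nonneg x
          simp; positivity
  · refine hJ.mono' ?_ ?_
    · refine Continuous.aestronglyMeasurable ?_
      simp only [Function.uncurry_def]; fun_prop
    · rw [Measure.prod_restrict]
      refine (ae_restrict_iff' (measurableSet_Ioi.prod measurableSet_Ioi)).2 ?_
      filter_upwards with p hp
      obtain ⟨y, v⟩ := p
      have hy : 0 < y := hp.1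
      exact F_bound hF y v _ hy.le (by nlinarith) (by linarith)

lemma norm_cexp_aux (x ξ : ℝ) : ‖cexp (-I * x * ξ)‖ = 1 := by
  rw [Complex.norm_exp]; simp

lemma F_cont (h : ℝ → ℂ) (hi : Integrable h) :
    Continuous fun x : ℝ => ∫ ξ : ℝ, h ξ * cexp (-I * x * ξ) := by
  refine continuous_of_dominated (bound := fun ξ => ‖h ξ‖) ?_ ?_ hi.norm ?_
  · intro x
    exact hi.aestronglyMeasurable.mul (by fun_prop)
  · intro x
    filter_upwards with ξ
    rw [norm_mul, norm_cexp_aux, mul_one]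
  · filter_upwards with ξ
    fun_prop

lemma sqrt_eq (ξ : ℝ) (hξ : ξ ≠ 0) :
    ((Real.pi : ℂ) / (I * ξ)) ^ (1 / 2 : ℂ) = (√Real.pi : ℂ) / sqrtIPlusZero ξ := by
  have hs : Real.sign ξ = 1 ∨ Real.sign ξ = -1 := by
    rcases lt_or_gt_of_ne hξ with h | h
    · right; exact Real.sign_of_neg h
    · left; exact Real.sign_of_pos h
  have hx : ξ = |ξ| * Real.sign ξ := by
    rcases lt_or_gt_of_ne hξ with h | h
    · rw [Real.sign_of_neg h, abs_of_neg h]; ring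
    · rw [Real.sign_of_pos h, abs_of_pos h]; ring
  have hpos : 0 < |ξ| := abs_pos.2 hξ
  have e : (Real.pi : ℂ) / (I * ξ) = ((Real.pi / |ξ| : ℝ) : ℂ) *
      cexp (((-(Real.pi * Real.sign ξ / 2) : ℝ) : ℂ) * I) := by
    have hξ' : (ξ : ℂ) ≠ 0 := by exact_mod_cast hξ
    have hp' : ((|ξ| : ℝ) : ℂ) ≠ 0 := by exact_mod_cast hpos.ne'
    rw [Complex.exp_mul_I, ← Complex.ofReal_cos, ← Complex.ofReal_sin]
    rcases hs with h | h
    · rw [h] at hx ⊢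
      have : (ξ : ℂ) = ((|ξ| : ℝ) : ℂ) := by conv_lhs => rw [hx, mul_one]
      rw [this]
      simp
      field_simp
      simp
    · rw [h] at hx ⊢
      have : (ξ : ℂ) = -((|ξ| : ℝ) : ℂ) := by conv_lhs => rw [hx]; simp
      rw [this]
      simp
      field_simp
      simp
  have harg : -(Real.pi * Real.sign ξ / 4) ∈ Ioc (-(Real.pi / 2)) (Real.pi / 2) := by
    have := Real.pi_pos
    rcases hs with h | h <;> rw [h] <;> constructor <;> linarith
  have hr : 0 < √Real.pi / √|ξ| := div_pos (Real.sqrt_pos.2 Real.pi_pos) (Real.sqrt_pos.2 hpos)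
  have ew : (√Real.pi : ℂ) / sqrtIPlusZero ξ = ((√Real.pi / √|ξ| : ℝ) : ℂ) *
      cexp (((-(Real.pi * Real.sign ξ / 4) : ℝ) : ℂ) * I) := by
    unfold sqrtIPlusZero
    have : (((-(Real.pi * Real.sign ξ / 4) : ℝ) : ℂ) * I) = -(I * (Real.pi : ℂ) * (Real.sign ξ : ℂ) / 4) := by
      push_cast; ring
    rw [this, Complex.exp_neg]
    push_cast
    rw [← div_div, div_eq_mul_inv _ (cexp _)]
  have ez : (Real.pi : ℂ) / (I * ξ) = ((√Real.pi : ℂ) / sqrtIPlusZero ξ) ^ 2 := by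
    rw [e, ew, mul_pow, ← Complex.exp_nat_mul, ← Complex.ofReal_pow, div_pow,
      Real.sq_sqrt Real.pi_pos.le, Real.sq_sqrt hpos.le]
    congr 2; push_cast; ring
  have ha : ((√Real.pi : ℂ) / sqrtIPlusZero ξ).arg = -(Real.pi * Real.sign ξ / 4) := by
    rw [ew, Complex.arg_real_mul _ hr, Complex.arg_exp_mul_I, toIocMod_eq_self]
    have := Real.pi_pos
    constructor <;> linarith [harg.1, harg.2]
  rw [ez]
  have := Complex.pow_cpow_nat_inv (x := (√Real.pi : ℂ) / sqrtIPlusZero ξ) (n := 2) (by norm_num)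
    (by rw [ha]; exact_mod_cast harg.1) (by rw [ha]; exact_mod_cast harg.2)
  simpa using this

lemma weight_int (h : ℝ → ℂ) (M : ℝ) (hi : Integrable h) (hM : ∀ ξ, ‖h ξ‖ ≤ M) :
    Integrable fun ξ : ℝ => ‖h ξ‖ * ‖ξ‖ ^ (-(1 / 2 : ℝ)) := by
  have hm : AEStronglyMeasurable (fun ξ : ℝ => ‖h ξ‖ * ‖ξ‖ ^ (-(1 / 2 : ℝ))) volume :=
    hi.norm.aestronglyMeasurable.mul (by fun_prop : Measurable fun ξ : ℝ => ‖ξ‖ ^ (-(1 / 2 : ℝ))).aestronglyMeasurable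
  rw [← integrableOn_univ, ← union_compl_self (Metric.ball (0 : ℝ) 1)]
  refine IntegrableOn.union ?_ ?_
  · refine integrableOn_ball_of_norm_le_rpow (C := M) (α := 1 / 2) (by simp) (by simp; norm_num) ?_ hm
    filter_upwards with x
    rw [norm_mul, norm_norm, Real.norm_of_nonneg (by positivity : 0 ≤ ‖x‖ ^ (-(1 / 2 : ℝ)))]
    gcongr
    exact hM x
  · refine Integrable.mono (hi.norm.restrict (s := (Metric.ball (0 : ℝ) 1)ᶜ)) hm.restrict ?_
    refine (ae_restrict_iff' Metric.isOpen_ball.measurableSet.compl).2 ?_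
    filter_upwards with x hx
    have : 1 ≤ ‖x‖ := by simpa using hx
    rw [norm_mul, norm_norm, Real.norm_of_nonneg (by positivity : 0 ≤ ‖x‖ ^ (-(1 / 2 : ℝ)))]
    exact mul_le_of_le_one_right (norm_nonneg _)
      (Real.rpow_le_one_of_one_le_of_nonpos this (by norm_num))

lemma fresnel_delta (h : ℝ → ℂ) (hi : Integrable h) (y δ : ℝ) (hδ : 0 < δ) :
    ∫ ξ : ℝ, h ξ * ((Real.pi : ℂ) / (δ + I * ξ)) ^ (1 / 2 : ℂ) * cexp (-I * y * ξ) =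
      2 * ∫ v in Ioi (0 : ℝ), cexp (-δ * v ^ 2) *
        ∫ ξ : ℝ, h ξ * cexp (-I * ((y + v ^ 2 : ℝ) : ℂ) * ξ) := by
  have e : ∀ ξ : ℝ, h ξ * ((Real.pi : ℂ) / (δ + I * ξ)) ^ (1 / 2 : ℂ) * cexp (-I * y * ξ) =
      2 * ∫ v in Ioi (0 : ℝ), h ξ * cexp (-I * y * ξ) * cexp (-(δ + I * ξ) * v ^ 2) := by
    intro ξ
    rw [integral_const_mul, integral_gaussian_complex_Ioi (by simpa using hδ)]
    ring
  simp_rw [e]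
  rw [integral_const_mul, integral_integral_swap]
  · congr 2
    ext v
    rw [← integral_const_mul]
    congr 1; ext ξ
    rw [mul_assoc, ← Complex.exp_add, mul_left_comm, ← Complex.exp_add]
    congr 2; push_cast; ring
  · have g : Integrable (fun v : ℝ => Real.exp (-δ * v ^ 2)) (volume.restrict (Ioi 0)) :=
      (integrable_exp_neg_mul_sq hδ).restrict
    refine (hi.norm.mul_prod g).mono' ?_ ?_
    · refine ((hi.aestronglyMeasurable.comp_fst).mul ?_).mul ?_
      · exact (by fun_prop : Continuous fun p : ℝ × ℝ => cexp (-I * y * p.1)).aestronglyMeasurable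
      · exact (by fun_prop : Continuous fun p : ℝ × ℝ =>
          cexp (-(δ + I * p.1) * p.2 ^ 2)).aestronglyMeasurable
    · filter_upwards with p
      simp only [Function.uncurry]
      rw [norm_mul, norm_mul, norm_cexp_aux, mul_one, Complex.norm_exp]
      gcongr
      rw [← Complex.ofReal_pow, Complex.re_mul_ofReal]
      simp

lemma fresnel (h : ℝ → ℂ) (M C : ℝ) (hi : Integrable h) (hM : ∀ ξ, ‖h ξ‖ ≤ M)
    (hF : ∀ x : ℝ, ‖∫ ξ : ℝ, h ξ * cexp (-I * x * ξ)‖ * (1 + x ^ 2) ≤ C) (y : ℝ) (hy : 0 ≤ y) :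
    ∫ ξ : ℝ, h ξ / sqrtIPlusZero ξ * cexp (-I * y * ξ) =
      (2 / √Real.pi : ℂ) * ∫ v in Ioi (0 : ℝ),
        ∫ ξ : ℝ, h ξ * cexp (-I * ((y + v ^ 2 : ℝ) : ℂ) * ξ) := by
  have hs : (√Real.pi : ℂ) ≠ 0 := by
    exact_mod_cast (Real.sqrt_pos.2 Real.pi_pos).ne'
  have t1 : Tendsto (fun δ : ℝ => ∫ ξ : ℝ,
      h ξ * ((Real.pi : ℂ) / (δ + I * ξ)) ^ (1 / 2 : ℂ) * cexp (-I * y * ξ)) (nhdsWithin 0 (Ioi 0))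
      (nhds (∫ ξ : ℝ, h ξ * ((√Real.pi : ℂ) / sqrtIPlusZero ξ) * cexp (-I * y * ξ))) := by
    refine tendsto_integral_filter_of_dominated_convergence
      (fun ξ => √Real.pi * (‖h ξ‖ * ‖ξ‖ ^ (-(1 / 2 : ℝ)))) ?_ ?_ ((weight_int h M hi hM).const_mul _) ?_
    · filter_upwards with δ
      refine (hi.aestronglyMeasurable.mul ?_).mul ?_
      · exact (by fun_prop : Measurable fun ξ : ℝ => ((Real.pi : ℂ) / (δ + I * ξ)) ^ (1 / 2 : ℂ)).aestronglyMeasurable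
      · exact (by fun_prop : Continuous fun ξ : ℝ => cexp (-I * y * ξ)).aestronglyMeasurable
    · filter_upwards with δ
      have h0 : ∀ᵐ ξ : ℝ, ξ ≠ 0 := by simp [ae_iff]
      filter_upwards [h0] with ξ hξ
      rw [norm_mul, norm_mul, norm_cexp_aux, mul_one, mul_left_comm]
      gcongr
      have : (1 / 2 : ℂ) = ((1 / 2 : ℝ) : ℂ) := by push_cast; rfl
      rw [this, Complex.norm_cpow_real, norm_div, Complex.norm_real,
        Real.norm_of_nonneg Real.pi_pos.le, Real.div_rpow Real.pi_pos.le (norm_nonneg _),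
        ← Real.sqrt_eq_rpow, div_eq_mul_inv, ← Real.rpow_neg (norm_nonneg _)]
      refine mul_le_mul_of_nonneg_left ?_ (Real.sqrt_nonneg _)
      refine Real.rpow_le_rpow_of_nonpos (norm_pos_iff.2 hξ) ?_ (by norm_num)
      have := Complex.abs_im_le_norm (δ + I * ξ)
      simpa using this
    · have h0 : ∀ᵐ ξ : ℝ, ξ ≠ 0 := by simp [ae_iff]
      filter_upwards [h0] with ξ hξ
      rw [← sqrt_eq ξ hξ]
      have hξ' : (ξ : ℂ) ≠ 0 := by exact_mod_cast hξ
      refine Tendsto.mul_const _ (Tendsto.const_mul _ ?_)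
      have hmem : (Real.pi : ℂ) / (I * ξ) ∈ slitPlane := by
        refine Or.inr ?_
        rw [Complex.div_im]
        simp [hξ, Real.pi_ne_zero]
      refine Tendsto.mono_left ?_ nhdsWithin_le_nhds
      have c1 : ContinuousAt (fun δ : ℝ => (Real.pi : ℂ) / (δ + I * ξ)) 0 := by
        refine ContinuousAt.div (by fun_prop) (by fun_prop) ?_
        simp [hξ]
      have := c1.cpow (continuousAt_const (y := (1 / 2 : ℂ))) (by simpa using hmem)
      simpa [ContinuousAt] using this
  have t2 : Tendsto (fun δ : ℝ => 2 * ∫ v in Ioi (0 : ℝ), cexp (-δ * v ^ 2) *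
        ∫ ξ : ℝ, h ξ * cexp (-I * ((y + v ^ 2 : ℝ) : ℂ) * ξ)) (nhdsWithin 0 (Ioi 0))
      (nhds (2 * ∫ v in Ioi (0 : ℝ), 
        ∫ ξ : ℝ, h ξ * cexp (-I * ((y + v ^ 2 : ℝ) : ℂ) * ξ))) := by
    refine Tendsto.const_mul _ ?_
    have hc : Continuous fun v : ℝ => ∫ ξ : ℝ, h ξ * cexp (-I * ((y + v ^ 2 : ℝ) : ℂ) * ξ) :=
      (F_cont h hi).comp (by fun_prop : Continuous fun v : ℝ => y + v ^ 2)
    refine tendsto_integral_filter_of_dominated_convergence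
      (fun v => 2 * C * (JJ y * JJ v)) ?_ ?_ ((JJ_int.restrict.const_mul _).const_mul _) ?_
    · filter_upwards with δ
      exact (Continuous.mul (by fun_prop) hc).aestronglyMeasurable
    · filter_upwards [self_mem_nhdsWithin] with δ hδ
      filter_upwards with v
      have hδ : 0 < δ := hδ
      rw [norm_mul]
      have b1 : ‖cexp (-δ * v ^ 2)‖ ≤ 1 := by
        rw [Complex.norm_exp, ← Complex.ofReal_pow, Complex.re_mul_ofReal]
        simp; positivity
      refine (mul_le_of_le_one_left (norm_nonneg _) b1).trans ?_
      exact F_bound (F := fun x : ℝ => ∫ ξ : ℝ, h ξ * cexp (-I * x * ξ)) hF y v (y + v ^ 2) hy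
        (by nlinarith) (by linarith)
    · filter_upwards with v
      refine Tendsto.mono_left ?_ nhdsWithin_le_nhds
      have : Continuous (fun δ : ℝ => cexp (-δ * v ^ 2) *
        ∫ ξ : ℝ, h ξ * cexp (-I * ((y + v ^ 2 : ℝ) : ℂ) * ξ)) := by
        exact Continuous.mul (by fun_prop) continuous_const
      simpa using this.tendsto 0
  have t3 := t2.congr' (by
    filter_upwards [self_mem_nhdsWithin] with δ hδ
    exact (fresnel_delta h hi y δ hδ).symm)
  have e := tendsto_nhds_unique t1 t3
  have e2 : ∫ ξ : ℝ, h ξ * ((√Real.pi : ℂ) / sqrtIPlusZero ξ) * cexp (-I * y * ξ) =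
      √Real.pi * ∫ ξ : ℝ, h ξ / sqrtIPlusZero ξ * cexp (-I * y * ξ) := by
    rw [← integral_const_mul]
    congr 1; ext ξ; ring
  rw [e2] at e
  rw [div_mul_eq_mul_div, eq_div_iff hs, ← e]; ring

lemma main_formula (h : ℝ → ℂ) (M C : ℝ) (hi : Integrable h) (hM : ∀ ξ, ‖h ξ‖ ≤ M)
    (hF : ∀ x : ℝ, ‖∫ ξ : ℝ, h ξ * cexp (-I * x * ξ)‖ * (1 + x ^ 2) ≤ C) (c : ℝ) (hc : 0 < c) :
    ∫ x in Ioi (0 : ℝ), ∫ ξ : ℝ, h ξ / sqrtIPlusZero ξ * cexp (-I * ((c⁻¹ * x : ℝ) : ℂ) * ξ) =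
      c * ((2 / √Real.pi : ℂ) * ∫ x in Ioi (0 : ℝ), ((√x : ℝ) : ℂ) *
        ∫ ξ : ℝ, h ξ * cexp (-I * x * ξ)) := by
  rw [integral_comp_mul_left_Ioi
    (fun y : ℝ => ∫ ξ : ℝ, h ξ / sqrtIPlusZero ξ * cexp (-I * (y : ℂ) * ξ)) 0 (inv_pos.2 hc)]
  rw [mul_zero, inv_inv, setIntegral_congr_fun measurableSet_Ioi
    (fun y hy => fresnel h M C hi hM hF y (le_of_lt hy)), integral_const_mul,
    double_int (fun x : ℝ => ∫ ξ : ℝ, h ξ * cexp (-I * x * ξ)) C (F_cont h hi) hF]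
  simp

lemma D_bound (K : SchwartzMap ℝ ℂ) : ∃ C : ℝ, ∀ ε : ℝ, 0 ≤ ε → ε ≤ 1 →
    Integrable (fun ξ : ℝ => K ξ * (cexp (I * ((-(ε * ξ ^ 3) : ℝ) : ℂ)) - 1)) ∧
    ∀ x : ℝ, ‖∫ ξ : ℝ, K ξ * (cexp (I * ((-(ε * ξ ^ 3) : ℝ) : ℂ)) - 1) * cexp (-I * x * ξ)‖
      * (1 + x ^ 2) ≤ ε * C := by
  let K1 := SchwartzMap.derivCLM ℝ ℂ K
  let K2 := SchwartzMap.derivCLM ℝ ℂ K1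
  have hK : ∀ x, HasDerivAt K (K1 x) x := fun x => K.hasDerivAt x
  have hK1 : ∀ x, HasDerivAt K1 (K2 x) x := fun x => K1.hasDerivAt x
  have p : ∀ (G : SchwartzMap ℝ ℂ) (k : ℕ), Integrable fun x : ℝ => |x| ^ k * ‖G x‖ :=
    fun G k => by simpa using G.integrable_pow_mul volume k
  let B0 : ℝ → ℝ := fun x => |x| ^ 3 * ‖K x‖
  let B1 : ℝ → ℝ := fun x => |x| ^ 3 * ‖K1 x‖ + 3 * (|x| ^ 2 * ‖K x‖)
  let B2 : ℝ → ℝ := fun x => |x| ^ 3 * ‖K2 x‖ + 6 * (|x| ^ 2 * ‖K1 x‖) + 6 * (|x| ^ 1 * ‖K x‖)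
    + 9 * (|x| ^ 4 * ‖K x‖)
  have iB0 : Integrable B0 := p K 3
  have iB1 : Integrable B1 := (p K1 3).add ((p K 2).const_mul 3)
  have iB2 : Integrable B2 := (((p K2 3).add ((p K1 2).const_mul 6)).add
    ((p K 1).const_mul 6)).add ((p K 4).const_mul 9)
  refine ⟨(∫ x, B0 x) + ∫ x, B2 x, fun ε h0 h1 => ?_⟩
  let E : ℝ → ℂ := fun ξ => cexp (I * ((-(ε * ξ ^ 3) : ℝ) : ℂ))
  let E1 : ℝ → ℂ := fun ξ => (-(3 * ε * ξ ^ 2) : ℝ) * I * E ξ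
  let E2 : ℝ → ℂ := fun ξ => (-(6 * ε * ξ) : ℝ) * I * E ξ + (-(9 * ε ^ 2 * ξ ^ 4) : ℝ) * E ξ
  have hE : ∀ ξ, HasDerivAt E (E1 ξ) ξ := by
    intro ξ
    have a : HasDerivAt (fun ξ : ℝ => -(ε * ξ ^ 3)) (-(ε * (3 * ξ ^ 2))) ξ := by
      simpa using ((hasDerivAt_pow 3 ξ).const_mul ε).fun_neg
    have := ((a.ofReal_comp).const_mul I).cexp
    refine this.congr_deriv ?_
    simp only [E1, E]; push_cast; ring
  have hE1 : ∀ ξ, HasDerivAt E1 (E2 ξ) ξ := by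
    intro ξ
    have a : HasDerivAt (fun ξ : ℝ => -(3 * ε * ξ ^ 2)) (-(3 * ε * (2 * ξ))) ξ := by
      simpa using ((hasDerivAt_pow 2 ξ).const_mul (3 * ε)).fun_neg
    have := ((a.ofReal_comp).mul_const I).mul (hE ξ)
    refine this.congr_deriv ?_
    simp only [E2, E1]; push_cast
    linear_combination (9 * ε ^ 2 * ξ ^ 4 * E ξ) * I_sq
  have nE : ∀ ξ, ‖E ξ‖ = 1 := by
    intro ξ; simp only [E]; rw [mul_comm]; exact Complex.norm_exp_ofReal_mul_I _
  have nE0 : ∀ ξ, ‖E ξ - 1‖ ≤ ε * |ξ| ^ 3 := by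
    intro ξ
    refine (Real.norm_exp_I_mul_ofReal_sub_one_le).trans (le_of_eq ?_)
    rw [Real.norm_eq_abs, abs_neg, abs_mul, abs_pow, abs_of_nonneg h0]
  have nE1 : ∀ ξ, ‖E1 ξ‖ ≤ ε * (3 * |ξ| ^ 2) := by
    intro ξ
    simp only [E1]
    rw [norm_mul, norm_mul, nE, Complex.norm_real, norm_I, Real.norm_eq_abs, abs_neg, abs_mul,
      abs_mul, abs_of_nonneg h0, abs_pow, abs_of_pos (by norm_num : (0:ℝ) < 3)]
    apply le_of_eq; ring
  have nE2 : ∀ ξ, ‖E2 ξ‖ ≤ ε * (6 * |ξ| ^ 1 + 9 * |ξ| ^ 4) := by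
    intro ξ
    simp only [E2]
    refine (norm_add_le _ _).trans ?_
    rw [norm_mul, norm_mul, norm_mul, nE, Complex.norm_real, Complex.norm_real, norm_I,
      Real.norm_eq_abs, Real.norm_eq_abs, abs_neg, abs_neg, abs_mul,
      abs_mul, abs_mul, abs_mul, abs_pow, abs_pow, abs_of_nonneg h0,
      abs_of_pos (by norm_num : (0:ℝ) < 6), abs_of_pos (by norm_num : (0:ℝ) < 9)]
    have : ε ^ 2 ≤ ε := by nlinarith
    have : 9 * ε ^ 2 * |ξ| ^ 4 ≤ 9 * ε * |ξ| ^ 4 := by gcongr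
    linarith
  let D : ℝ → ℂ := fun ξ => K ξ * (E ξ - 1)
  let D1 : ℝ → ℂ := fun ξ => K1 ξ * (E ξ - 1) + K ξ * E1 ξ
  let D2 : ℝ → ℂ := fun ξ => (K2 ξ * (E ξ - 1) + K1 ξ * E1 ξ) + (K1 ξ * E1 ξ + K ξ * E2 ξ)
  have hD : ∀ ξ, HasDerivAt D (D1 ξ) ξ := fun ξ => (hK ξ).mul ((hE ξ).sub_const 1)
  have hD1 : ∀ ξ, HasDerivAt D1 (D2 ξ) ξ := fun ξ =>
    ((hK1 ξ).mul ((hE ξ).sub_const 1)).add ((hK ξ).mul (hE1 ξ))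
  have bD : ∀ ξ, ‖D ξ‖ ≤ ε * B0 ξ := by
    intro ξ
    simp only [D, B0]
    rw [norm_mul]
    have := mul_le_mul_of_nonneg_left (nE0 ξ) (norm_nonneg (K ξ))
    linarith
  have bD1 : ∀ ξ, ‖D1 ξ‖ ≤ ε * B1 ξ := by
    intro ξ
    simp only [D1, B1]
    refine (norm_add_le _ _).trans ?_
    rw [norm_mul, norm_mul]
    have := mul_le_mul_of_nonneg_left (nE0 ξ) (norm_nonneg (K1 ξ))
    have := mul_le_mul_of_nonneg_left (nE1 ξ) (norm_nonneg (K ξ))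
    linarith
  have bD2 : ∀ ξ, ‖D2 ξ‖ ≤ ε * B2 ξ := by
    intro ξ
    simp only [D2, B2]
    refine (norm_add_le _ _).trans ((add_le_add (norm_add_le _ _) (norm_add_le _ _)).trans ?_)
    rw [norm_mul (K2 ξ), norm_mul (K1 ξ), norm_mul (K ξ)]
    have := mul_le_mul_of_nonneg_left (nE0 ξ) (norm_nonneg (K2 ξ))
    have := mul_le_mul_of_nonneg_left (nE1 ξ) (norm_nonneg (K1 ξ))
    have := mul_le_mul_of_nonneg_left (nE2 ξ) (norm_nonneg (K ξ))
    linarith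
  have cE : Continuous E := by fun_prop
  have cE1 : Continuous E1 := by fun_prop
  have cE2 : Continuous E2 := by fun_prop
  have cK := K.continuous
  have cK1 := K1.continuous
  have cK2 := K2.continuous
  have iD : Integrable D := (iB0.const_mul ε).mono' (by fun_prop) (Eventually.of_forall bD)
  have iD1 : Integrable D1 := (iB1.const_mul ε).mono' (by fun_prop) (Eventually.of_forall bD1)
  have iD2 : Integrable D2 := (iB2.const_mul ε).mono' (by fun_prop) (Eventually.of_forall bD2)
  refine ⟨iD, fun x => (aux_decay D D1 D2 hD hD1 iD iD1 iD2 x).trans ?_⟩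
  rw [mul_add, ← integral_const_mul, ← integral_const_mul]
  exact add_le_add (integral_mono iD.norm (iB0.const_mul ε) bD)
    (integral_mono iD2.norm (iB2.const_mul ε) bD2)

open FourierTransform in
lemma exists_K (f : SchwartzMap ℝ ℂ) : ∃ K : SchwartzMap ℝ ℂ, (∀ ξ, K ξ = fourierHat f ξ) ∧
    ∀ x : ℝ, ∫ ξ : ℝ, K ξ * cexp (-I * x * ξ) = (√(2 * Real.pi) : ℂ) * f (-x) := by
  have hp : (0 : ℝ) < 2 * Real.pi := by positivity
  let L : ℝ ≃L[ℝ] ℝ := ContinuousLinearEquiv.unitsEquivAut ℝ (Units.mk0 (2 * Real.pi)⁻¹ (by positivity))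
  have hL : ∀ x, L x = (2 * Real.pi)⁻¹ * x := by
    intro x; simp [L, ContinuousLinearEquiv.unitsEquivAut, mul_comm]
  let a : ℂ := (((2 * Real.pi : ℝ) ^ (-(1 : ℝ) / 2) : ℝ) : ℂ)
  let K : SchwartzMap ℝ ℂ := a • SchwartzMap.compCLMOfContinuousLinearEquiv ℂ L (𝓕 f)
  have hK : ∀ ξ, K ξ = a * (𝓕 (f : ℝ → ℂ)) ((2 * Real.pi)⁻¹ * ξ) := by
    intro ξ
    simp [K, hL, SchwartzMap.fourier_coe]
  refine ⟨K, fun ξ => ?_, fun x => ?_⟩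
  · rw [hK, fourierHat, Real.fourier_real_eq_integral_exp_smul]
    congr 2; ext t
    rw [smul_eq_mul, mul_comm]
    congr 2
    have : (Real.pi : ℂ) ≠ 0 := by exact_mod_cast Real.pi_ne_zero
    push_cast; field_simp
  · obtain ⟨g, hg⟩ : ∃ g : ℝ → ℂ, g = fun w : ℝ => (𝓕 (f : ℝ → ℂ)) w *
        cexp (((-2 * Real.pi * w * x : ℝ) : ℂ) * I) := ⟨_, rfl⟩
    have e1 : ∀ ξ : ℝ, K ξ * cexp (-I * x * ξ) = a * g ((2 * Real.pi)⁻¹ * ξ) := by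
      intro ξ
      rw [hK, hg]; simp only
      rw [mul_assoc]
      congr 3
      have : (Real.pi : ℂ) ≠ 0 := by exact_mod_cast Real.pi_ne_zero
      push_cast; field_simp
    rw [integral_congr_ae (Eventually.of_forall e1)]
    rw [integral_const_mul, Measure.integral_comp_mul_left g, hg]
    have e2 : ∫ w : ℝ, (𝓕 (f : ℝ → ℂ)) w * cexp (((-2 * Real.pi * w * x : ℝ) : ℂ) * I) = f (-x) := by
      have : 𝓕 (𝓕 (f : ℝ → ℂ)) x = f (-x) := by
        have := congrFun (f.continuous.fourierInv_fourier_eq f.integrable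
          (by rw [← SchwartzMap.fourier_coe]; exact (𝓕 f).integrable)) (-x)
        rw [← this, Real.fourierInv_eq_fourier_neg, neg_neg]
      rw [← this, Real.fourier_real_eq_integral_exp_smul]
      congr 1; ext w
      rw [smul_eq_mul, mul_comm]
    rw [e2, inv_inv, abs_of_pos hp, Complex.real_smul, ← mul_assoc]
    congr 1
    simp only [a]
    rw [← Complex.ofReal_mul]
    congr 1
    rw [Real.sqrt_eq_rpow]
    nth_rewrite 2 [← Real.rpow_one (2 * Real.pi)]
    rw [← Real.rpow_add hp]
    norm_num

lemma W_le (x : ℝ) (hx : 0 ≤ x) : √x * (1 / (1 + x ^ 2)) ≤ JJ x := by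
  have hp : (0 : ℝ) < 1 + x ^ 2 := by positivity
  have h1 : √x ≤ (1 + x ^ 2) ^ (1 / 3 : ℝ) := by
    calc √x = (x ^ 2) ^ (1 / 4 : ℝ) := by
          rw [Real.sqrt_eq_rpow, ← Real.rpow_natCast, ← Real.rpow_mul hx]; norm_num
      _ ≤ (1 + x ^ 2) ^ (1 / 4 : ℝ) := by
          apply Real.rpow_le_rpow (by positivity) (by linarith) (by norm_num)
      _ ≤ _ := Real.rpow_le_rpow_of_exponent_le (by nlinarith) (by norm_num)
  have h2 : JJ x = (1 + x ^ 2) ^ (1 / 3 : ℝ) * (1 / (1 + x ^ 2)) := by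
    unfold JJ
    rw [Real.norm_eq_abs, sq_abs, one_div (1 + x ^ 2)]
    nth_rewrite 3 [← Real.rpow_one (1 + x ^ 2)]
    rw [← Real.rpow_neg hp.le, ← Real.rpow_add hp]
    norm_num
  rw [h2]
  gcongr

lemma W_bound (F : ℝ → ℂ) (C : ℝ) (hF : ∀ x, ‖F x‖ * (1 + x ^ 2) ≤ C) (x : ℝ) (hx : 0 ≤ x) :
    ‖((√x : ℝ) : ℂ) * F x‖ ≤ C * JJ x := by
  have hC : 0 ≤ C := le_trans (by positivity) (hF 0)
  have : ‖F x‖ ≤ C * (1 / (1 + x ^ 2)) := by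
    rw [mul_one_div, le_div_iff₀ (by positivity)]; exact hF x
  rw [norm_mul, Complex.norm_real, Real.norm_of_nonneg (Real.sqrt_nonneg x)]
  calc √x * ‖F x‖ ≤ √x * (C * (1 / (1 + x ^ 2))) := by gcongr
    _ = C * (√x * (1 / (1 + x ^ 2))) := by ring
    _ ≤ _ := by gcongr; exact W_le x hx

lemma W_ae (F : ℝ → ℂ) (C : ℝ) (hF : ∀ x, ‖F x‖ * (1 + x ^ 2) ≤ C) :
    ∀ᵐ x ∂(volume.restrict (Ioi (0 : ℝ))), ‖((√x : ℝ) : ℂ) * F x‖ ≤ C * JJ x :=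
  (ae_restrict_iff' measurableSet_Ioi).2
    (Eventually.of_forall fun x hx => W_bound F C hF x (le_of_lt hx))

lemma W_integrable (F : ℝ → ℂ) (C : ℝ) (hc : Continuous F) (hF : ∀ x, ‖F x‖ * (1 + x ^ 2) ≤ C) :
    Integrable (fun x : ℝ => ((√x : ℝ) : ℂ) * F x) (volume.restrict (Ioi (0 : ℝ))) :=
  (JJ_int.restrict.const_mul C).mono' (by fun_prop) (W_ae F C hF)

lemma W_int_le (F : ℝ → ℂ) (C : ℝ) (hF : ∀ x, ‖F x‖ * (1 + x ^ 2) ≤ C) :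
    ‖∫ x in Ioi (0 : ℝ), ((√x : ℝ) : ℂ) * F x‖ ≤ C * ∫ x in Ioi (0 : ℝ), JJ x := by
  rw [← integral_const_mul]
  exact norm_integral_le_of_norm_le (JJ_int.restrict.const_mul C) (W_ae F C hF)

/-- For every Schwartz function `f`, as `α → ∞`,
`(1/(√8 π)) ∫_0^∞ ∫_ℝ (f̂(ξ)/√(iξ+0)) e^{-iξ³/(12α³)} e^{-ixξ/α^{3/2}} dξ dx
  = (α^{3/2}/π) ∫_0^∞ √x · f(−x) dx + O(α^{-3/2})`
(the iterated integral is over `ξ ∈ ℝ` first, then over `x ∈ (0,∞)`; this is the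
trace of the operator `P B_α(f) P`). -/
theorem trace_asymptotics
    (f : SchwartzMap ℝ ℂ) :
    (fun α : ℝ =>
        (1 / (Real.sqrt 8 * Real.pi) : ℂ) *
          (∫ x in Ioi (0 : ℝ), ∫ ξ : ℝ,
            (fourierHat (⇑f) ξ / sqrtIPlusZero ξ) *
              Complex.exp (-Complex.I * (ξ : ℂ) ^ 3 / (12 * (α : ℂ) ^ 3)) *
              Complex.exp (-Complex.I * (x : ℂ) * (ξ : ℂ) / ((α ^ ((3 : ℝ) / 2) : ℝ) : ℂ)))
        - (((α ^ ((3 : ℝ) / 2) : ℝ) : ℂ) / (Real.pi : ℂ)) *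
            ∫ x in Ioi (0 : ℝ), ((Real.sqrt x : ℝ) : ℂ) * f (-x))
      =O[atTop] fun α : ℝ => α ^ (-(3 : ℝ) / 2) := by
  obtain ⟨K, hKf, hKF⟩ := exists_K f
  obtain ⟨CD, hCD⟩ := D_bound K
  have cK := K.continuous
  have iK : Integrable K := K.integrable
  obtain ⟨CK, hCK⟩ : ∃ C, ∀ x : ℝ, ‖∫ ξ : ℝ, K ξ * cexp (-I * x * ξ)‖ * (1 + x ^ 2) ≤ C :=
    ⟨_, fun x => aux_decay K (SchwartzMap.derivCLM ℝ ℂ K)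
      (SchwartzMap.derivCLM ℝ ℂ (SchwartzMap.derivCLM ℝ ℂ K)) (fun x => K.hasDerivAt x)
      (fun x => (SchwartzMap.derivCLM ℝ ℂ K).hasDerivAt x) K.integrable
      (SchwartzMap.integrable _) (SchwartzMap.integrable _) x⟩
  obtain ⟨M, hM⟩ : ∃ M, ∀ x, ‖K x‖ ≤ M :=
    ⟨_, fun x => SchwartzMap.norm_le_seminorm ℝ K x⟩
  refine IsBigO.of_bound (‖(1 / (√8 * Real.pi) : ℂ) * (2 / √Real.pi : ℂ)‖ *
    (1 / 12 * CD * ∫ x in Ioi (0 : ℝ), JJ x)) ?_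
  filter_upwards [eventually_ge_atTop 1] with α hα
  have hα0 : 0 < α := by linarith
  obtain ⟨c, hc⟩ : ∃ c, c = α ^ ((3 : ℝ) / 2) := ⟨_, rfl⟩
  rw [← hc]
  have hc0 : 0 < c := by rw [hc]; positivity
  obtain ⟨ε, hε⟩ : ∃ ε, ε = 1 / (12 * α ^ 3) := ⟨_, rfl⟩
  have hε0 : 0 ≤ ε := by rw [hε]; positivity
  have hε1 : ε ≤ 1 := by
    rw [hε, div_le_one (by positivity)]
    have := one_le_pow₀ hα (n := 3); linarith
  have hcε : c * ε = 1 / 12 * α ^ (-(3 : ℝ) / 2) := by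
    rw [hc, hε, ← Real.rpow_natCast, one_div_mul_eq_div, mul_one_div, mul_comm (12 : ℝ), ← div_div,
      ← Real.rpow_sub hα0]
    norm_num
  obtain ⟨iD, hD⟩ := hCD ε hε0 hε1
  let D : ℝ → ℂ := fun ξ => K ξ * (cexp (I * ((-(ε * ξ ^ 3) : ℝ) : ℂ)) - 1)
  let h : ℝ → ℂ := fun ξ => K ξ * cexp (I * ((-(ε * ξ ^ 3) : ℝ) : ℂ))
  have hh : ∀ ξ, h ξ = K ξ + D ξ := fun ξ => by simp only [h, D]; ring
  have hmul : ∀ G : ℝ → ℂ, Integrable G → ∀ x : ℝ, Integrable fun ξ : ℝ => G ξ * cexp (-I * x * ξ) := by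
    intro G hG x
    refine hG.mono (hG.aestronglyMeasurable.mul (by fun_prop)) ?_
    filter_upwards with ξ
    rw [norm_mul, norm_cexp_aux, mul_one]
  have ih : Integrable h := (iK.add iD).congr (Eventually.of_forall fun ξ => (hh ξ).symm)
  have hFh : ∀ x : ℝ, ∫ ξ : ℝ, h ξ * cexp (-I * x * ξ) =
      (∫ ξ : ℝ, K ξ * cexp (-I * x * ξ)) + ∫ ξ : ℝ, D ξ * cexp (-I * x * ξ) := by
    intro x
    rw [← integral_add (hmul _ iK x) (hmul _ iD x)]
    congr 1; ext ξ; rw [hh]; ring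
  have hMh : ∀ ξ, ‖h ξ‖ ≤ M := by
    intro ξ
    simp only [h]
    rw [norm_mul, mul_comm I, Complex.norm_exp_ofReal_mul_I, mul_one]
    exact hM ξ
  have hCh : ∀ x : ℝ, ‖∫ ξ : ℝ, h ξ * cexp (-I * x * ξ)‖ * (1 + x ^ 2) ≤ CK + ε * CD := by
    intro x
    rw [hFh]
    calc _ ≤ (‖∫ ξ : ℝ, K ξ * cexp (-I * x * ξ)‖ + ‖∫ ξ : ℝ, D ξ * cexp (-I * x * ξ)‖) * (1 + x ^ 2) := by
          gcongr; exact norm_add_le _ _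
      _ ≤ _ := by rw [add_mul]; exact add_le_add (hCK x) (hD x)
  have e1 : ∀ x ξ : ℝ, (fourierHat (⇑f) ξ / sqrtIPlusZero ξ) *
              Complex.exp (-Complex.I * (ξ : ℂ) ^ 3 / (12 * (α : ℂ) ^ 3)) *
              Complex.exp (-Complex.I * (x : ℂ) * (ξ : ℂ) / (c : ℂ)) =
      h ξ / sqrtIPlusZero ξ * cexp (-I * ((c⁻¹ * x : ℝ) : ℂ) * ξ) := by
    intro x ξ
    simp only [h]
    rw [hKf, hε]
    have a1 : -Complex.I * (ξ : ℂ) ^ 3 / (12 * (α : ℂ) ^ 3) =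
      I * ((-(1 / (12 * α ^ 3) * ξ ^ 3) : ℝ) : ℂ) := by push_cast; ring
    have a2 : -Complex.I * (x : ℂ) * (ξ : ℂ) / (c : ℂ) = -I * ((c⁻¹ * x : ℝ) : ℂ) * ξ := by
      push_cast; ring
    rw [a1, a2]; ring
  simp_rw [e1]
  rw [main_formula h M _ ih hMh hCh c hc0]
  simp_rw [hFh, mul_add]
  rw [integral_add (W_integrable _ CK (F_cont _ iK) hCK) (W_integrable _ (ε * CD) (F_cont _ iD) hD)]
  simp_rw [hKF]
  have e2 : ∫ x in Ioi (0 : ℝ), ((√x : ℝ) : ℂ) * ((√(2 * Real.pi) : ℂ) * f (-x)) =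
      (√(2 * Real.pi) : ℂ) * ∫ x in Ioi (0 : ℝ), ((√x : ℝ) : ℂ) * f (-x) := by
    rw [← integral_const_mul]; congr 1; ext x; ring
  rw [e2]
  have e3 : (1 / (√8 * Real.pi) : ℂ) * (c * ((2 / √Real.pi : ℂ) * (√(2 * Real.pi) : ℂ))) = c / Real.pi := by
    have r8 : √8 = 2 * √2 := by
      rw [show (8 : ℝ) = 2 ^ 2 * 2 by norm_num, Real.sqrt_mul (by norm_num), Real.sqrt_sq (by norm_num)]
    rw [r8, Real.sqrt_mul (by norm_num)]
    have h1 : (√2 : ℂ) ≠ 0 := by exact_mod_cast (Real.sqrt_pos.2 (by norm_num : (0:ℝ) < 2)).ne'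
    have h2 : (√Real.pi : ℂ) ≠ 0 := by exact_mod_cast (Real.sqrt_pos.2 Real.pi_pos).ne'
    have h3 : (Real.pi : ℂ) ≠ 0 := by exact_mod_cast Real.pi_ne_zero
    push_cast
    field_simp
  have e4 : ∀ A B : ℂ, (1 / (√8 * Real.pi) : ℂ) * (c * ((2 / √Real.pi : ℂ) * ((√(2 * Real.pi) : ℂ) * A)
      + (2 / √Real.pi : ℂ) * B)) - c / Real.pi * A =
      (1 / (√8 * Real.pi) : ℂ) * (2 / √Real.pi : ℂ) * (c * B) := by
    intro A B
    rw [← e3]; ring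
  have hb := W_int_le (fun x : ℝ => ∫ ξ : ℝ, D ξ * cexp (-I * x * ξ)) (ε * CD) hD
  have e5 := e4 (∫ x in Ioi (0 : ℝ), ((√x : ℝ) : ℂ) * f (-x))
    (∫ x in Ioi (0 : ℝ), ((√x : ℝ) : ℂ) * ∫ ξ : ℝ, D ξ * cexp (-I * x * ξ))
  rw [← mul_add] at e5
  refine le_trans (le_of_eq (congrArg norm e5)) ?_
  rw [norm_mul, mul_assoc]
  refine mul_le_mul_of_nonneg_left ?_ (norm_nonneg _)
  rw [norm_mul, Complex.norm_real, Real.norm_of_nonneg hc0.le,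
    Real.norm_of_nonneg (Real.rpow_nonneg hα0.le _)]
  calc _ ≤ c * (ε * CD * ∫ x in Ioi (0 : ℝ), JJ x) := by gcongr
    _ = c * ε * (CD * ∫ x in Ioi (0 : ℝ), JJ x) := by ring
    _ = _ := by rw [hcε]; ring
end
end
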